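/- arXiv:2506.22564 — 10 statements merged into one kernel-verified Lean document; each statement's English description precedes it below -/
import Mathlib

section
/- Let R be a commutative ring, n ≥ 1, B a finite subset of ℕ^n, and h : ℕ^n → R any function. Define the B × B matrices H := (h(γ+δ))_{γ,δ ∈ B} and, for each 1 ≤ i ≤ n, H_i := (h(γ+δ+e_i))_{γ,δ ∈ B}. For α, β ∈ B and i, j ∈ {1,…,n}, let M(α,i; β,j) be the (|B|+1) × (|B|+1) matrix whose (γ,δ)-entry is h(γ+δ) for γ, δ ∈ B, whose last column has entries h(γ+β+e_j) for γ ∈ B, whose last row has entries h(α+δ+e_i) for δ ∈ B, and whose bottom-right corner is h(α+β+e_i+e_j). Then for all α, β ∈ B and all i, j: (H_i · adj(H) · H_j − H_j · adj(H) · H_i)_{α,β} = det M(α,j; β,i) − det M(α,i; β,j). In particular, when det(H) is a unit of R, the commuting relations M_i M_j = M_j M_i for the multiplication matrices M_i := H_i · H^{−1} hold if and only if all the determinantal differences det M(α,i;β,j) − det M(α,j;β,i) vanish; i.e., the determinantal relations and the commuting relations of the moment matrix extension algorithm are equivalent up to a global factor of det(H). -/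
open scoped BigOperators

/-- The principal Hankel block `𝓗_{B,B}`, with entries `h(γ+δ)` for `γ, δ ∈ B`. -/
def hankelH (R : Type*) [CommRing R] (n : ℕ) (B : Finset (Fin n → ℕ))
    (h : (Fin n → ℕ) → R) : Matrix {x // x ∈ B} {x // x ∈ B} R :=
  Matrix.of fun γ δ => h (γ.1 + δ.1)

/-- The shifted Hankel block `𝓗_{B,B_i}`, with entries `h(γ+δ+e_i)`. -/
def hankelHi (R : Type*) [CommRing R] (n : ℕ) (B : Finset (Fin n → ℕ))
    (h : (Fin n → ℕ) → R) (i : Fin n) : Matrix {x // x ∈ B} {x // x ∈ B} R :=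
  Matrix.of fun γ δ => h (γ.1 + δ.1 + Pi.single i 1)

/-- The bordered Hankel matrix `M(α,i;β,j) = 𝓗_{B∪{x^α x_i}, B∪{x^β x_j}}`:
Hankel block `h(γ+δ)`, last column `h(γ+β+e_j)`, last row `h(α+δ+e_i)`,
corner `h(α+β+e_i+e_j)`. -/
def borderedH (R : Type*) [CommRing R] (n : ℕ) (B : Finset (Fin n → ℕ))
    (h : (Fin n → ℕ) → R) (α : Fin n → ℕ) (i : Fin n) (β : Fin n → ℕ) (j : Fin n) :
    Matrix ({x // x ∈ B} ⊕ Unit) ({x // x ∈ B} ⊕ Unit) R :=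
  Matrix.fromBlocks
    (Matrix.of fun γ δ => h (γ.1 + δ.1))
    (Matrix.of fun γ (_ : Unit) => h (γ.1 + β + Pi.single j 1))
    (Matrix.of fun (_ : Unit) δ => h (α + δ.1 + Pi.single i 1))
    (Matrix.of fun (_ : Unit) (_ : Unit) => h (α + β + Pi.single i 1 + Pi.single j 1))

open Polynomial in
theorem bordered_aux_regular {R m : Type*} [CommRing R] [Fintype m] [DecidableEq m]
    (A : Matrix m m R) (u : Matrix m Unit R) (v : Matrix Unit m R) (d : Matrix Unit Unit R)
    (hA : IsRegular A.det) :
    (Matrix.fromBlocks A u v d).det = d () () * A.det - (v * A.adjugate * u) () () := by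
  have key : Matrix.fromBlocks A u v d *
      Matrix.fromBlocks 1 (-(A.adjugate * u)) 0 (A.det • (1 : Matrix Unit Unit R))
      = Matrix.fromBlocks A 0 v (A.det • d - v * A.adjugate * u) := by
    rw [Matrix.fromBlocks_multiply]
    congr 1
    · simp
    · rw [Matrix.mul_neg, ← Matrix.mul_assoc, Matrix.mul_adjugate]
      simp
    · simp
    · rw [Matrix.mul_neg, ← Matrix.mul_assoc]
      simp [sub_eq_add_neg, add_comm]
  have h2 := congrArg Matrix.det key
  rw [Matrix.det_mul, Matrix.det_fromBlocks_zero₂₁, Matrix.det_fromBlocks_zero₁₂] at h2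
  apply hA.right
  simp only [Matrix.det_unique, Matrix.det_one] at h2 ⊢
  simp at h2
  simp only [h2]
  ring

open Polynomial in
theorem bordered_aux {R m : Type*} [CommRing R] [Fintype m] [DecidableEq m]
    (A : Matrix m m R) (u : Matrix m Unit R) (v : Matrix Unit m R) (d : Matrix Unit Unit R) :
    (Matrix.fromBlocks A u v d).det = d () () * A.det - (v * A.adjugate * u) () () := by
  have h1 := bordered_aux_regular (Matrix.charmatrix (-A)) (u.map C) (v.map C) (d.map C)
    (Matrix.charpoly_monic (-A)).isRegular
  have hA : (Matrix.charmatrix (-A)).map (evalRingHom (0 : R)) = A := by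
    ext i j
    by_cases hij : i = j
    · subst hij; simp
    · simp [Matrix.charmatrix_apply_ne _ _ _ hij]
  have hu : (u.map C).map (evalRingHom (0 : R)) = u := by ext; simp
  have hv : (v.map C).map (evalRingHom (0 : R)) = v := by ext; simp
  have hd : (d.map C).map (evalRingHom (0 : R)) = d := by ext; simp
  have h2 := congrArg (evalRingHom (0 : R)) h1
  have e : (evalRingHom (0 : R)) ((v.map C * (Matrix.charmatrix (-A)).adjugate * u.map C) () ())
      = (v * A.adjugate * u) () () := by
    have : ((v.map C * (Matrix.charmatrix (-A)).adjugate * u.map C).map (evalRingHom (0 : R)))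
        = v * A.adjugate * u := by
      rw [Matrix.map_mul, Matrix.map_mul, hu, hv]
      have := RingHom.map_adjugate (evalRingHom (0 : R)) (Matrix.charmatrix (-A))
      simp only [RingHom.mapMatrix_apply] at this
      rw [this, hA]
    exact congrFun (congrFun this ()) ()
  rw [map_sub, map_mul, RingHom.map_det, RingHom.map_det, e] at h2
  simp only [RingHom.mapMatrix_apply, Matrix.fromBlocks_map, hu, hv, hd, hA] at h2
  simpa using h2

theorem bordered_det (R : Type*) [CommRing R] (n : ℕ)
    (B : Finset (Fin n → ℕ)) (h : (Fin n → ℕ) → R) (α β : {x // x ∈ B}) (i j : Fin n) :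
    (borderedH R n B h α.1 i β.1 j).det
      = h (α.1 + β.1 + Pi.single i 1 + Pi.single j 1) * (hankelH R n B h).det
        - (hankelHi R n B h i * (hankelH R n B h).adjugate * hankelHi R n B h j) α β := by
  rw [borderedH, bordered_aux]
  rfl

/-- Equivalence of the determinantal relations and the commuting relations of the
moment matrix extension algorithm, up to a global factor of `det H`. -/
theorem statement3 (R : Type*) [CommRing R] (n : ℕ) (hn : 1 ≤ n)
    (B : Finset (Fin n → ℕ)) (h : (Fin n → ℕ) → R) :
    (∀ (α β : {x // x ∈ B}) (i j : Fin n),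
      (hankelHi R n B h i * (hankelH R n B h).adjugate * hankelHi R n B h j
        - hankelHi R n B h j * (hankelH R n B h).adjugate * hankelHi R n B h i) α β
      = (borderedH R n B h α.1 j β.1 i).det - (borderedH R n B h α.1 i β.1 j).det)
    ∧ (IsUnit (hankelH R n B h).det →
        ((∀ i j : Fin n,
            hankelHi R n B h i * (hankelH R n B h)⁻¹
                * (hankelHi R n B h j * (hankelH R n B h)⁻¹)
              = hankelHi R n B h j * (hankelH R n B h)⁻¹
                * (hankelHi R n B h i * (hankelH R n B h)⁻¹)) ↔
          (∀ (α β : {x // x ∈ B}) (i j : Fin n),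
            (borderedH R n B h α.1 i β.1 j).det
              = (borderedH R n B h α.1 j β.1 i).det))) := by
  have main : ∀ (α β : {x // x ∈ B}) (i j : Fin n),
      (hankelHi R n B h i * (hankelH R n B h).adjugate * hankelHi R n B h j
        - hankelHi R n B h j * (hankelH R n B h).adjugate * hankelHi R n B h i) α β
      = (borderedH R n B h α.1 j β.1 i).det - (borderedH R n B h α.1 i β.1 j).det := by
    intro α β i j
    rw [bordered_det, bordered_det, Matrix.sub_apply,
      add_right_comm (α.1 + β.1) (Pi.single j 1) (Pi.single i 1)]
    ring
  refine ⟨main, fun hu => ?_⟩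
  set H := hankelH R n B h with hH
  have hadj : H.adjugate = H.det • H⁻¹ := by
    rw [Matrix.inv_def, smul_smul, Ring.mul_inverse_cancel _ hu, one_smul]
  have step : ∀ i j : Fin n,
      (hankelHi R n B h i * H⁻¹ * (hankelHi R n B h j * H⁻¹)
        = hankelHi R n B h j * H⁻¹ * (hankelHi R n B h i * H⁻¹)) ↔
      hankelHi R n B h i * H.adjugate * hankelHi R n B h j
        = hankelHi R n B h j * H.adjugate * hankelHi R n B h i := by
    intro i j
    rw [hadj]
    simp only [Matrix.mul_smul, Matrix.smul_mul]
    rw [hu.smul_left_cancel, ← Matrix.mul_assoc, ← Matrix.mul_assoc]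
    constructor
    · intro e
      have e2 := congrArg (· * H) e
      simpa [Matrix.nonsing_inv_mul_cancel_right _ _ hu] using e2
    · intro e
      rw [e]
  constructor
  · intro hc α β i j
    have := main α β i j
    rw [(step i j).1 (hc i j), sub_self, Matrix.zero_apply] at this
    exact (sub_eq_zero.1 this.symm).symm
  · intro hd i j
    rw [step, ← sub_eq_zero]
    ext α β
    rw [main, hd α β i j, sub_self, Matrix.zero_apply]
end

section
/- Let z_1, …, z_s ∈ ℂ^n, let λ_1, …, λ_s ∈ ℂ be all nonzero, and let d ∈ ℕ. Define φ_γ := Σ_{i=1}^s λ_i z_i^γ for γ ∈ ℕ^n with |γ| ≤ d. For 0 ≤ k ≤ d let Cat_k(φ) be the matrix with rows indexed by multi-indices α with |α| ≤ d−k, columns indexed by multi-indices β with |β| ≤ k, and (α,β)-entry φ_{α+β}; and let Z_k be the s × C(n+k,n) matrix with (i,α)-entry z_i^α for |α| ≤ k. If D ∈ ℕ satisfies rank(Z_D) = s, then for every k with 0 ≤ k ≤ d − D one has rank(Cat_k(φ)) = rank(Z_k). -/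
open scoped BigOperators

/-- The set of multi-indices of total degree at most `k` is finite. -/
lemma finiteDegLe (m k : ℕ) : {γ : Fin m → ℕ | ∑ j, γ j ≤ k}.Finite := by
  apply Set.Finite.subset (Set.Finite.pi (fun _ : Fin m => Set.finite_Iic k))
  intro γ hγ j _
  exact le_trans (Finset.single_le_sum (fun i _ => Nat.zero_le (γ i)) (Finset.mem_univ j)) hγ

noncomputable instance (m k : ℕ) : Fintype {γ : Fin m → ℕ // ∑ j, γ j ≤ k} :=
  (finiteDegLe m k).fintype

/-- The `k`-th (dehomogenized) Vandermonde matrix of the points `z 1, …, z s`. -/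
noncomputable def vand (n s : ℕ) (z : Fin s → Fin n → ℂ) (k : ℕ) :
    Matrix (Fin s) {γ : Fin n → ℕ // ∑ j, γ j ≤ k} ℂ :=
  Matrix.of fun i γ => ∏ j, z i j ^ γ.1 j

/-- The `k`-th catalecticant matrix of `φ = Σ_i λ_i z_i^{⊗d}` (dehomogenized):
rows indexed by `|α| ≤ d−k`, columns by `|β| ≤ k`, entries `φ_{α+β}`. -/
noncomputable def catOfPoints (n s d : ℕ) (z : Fin s → Fin n → ℂ) (lam : Fin s → ℂ)
    (k : ℕ) :
    Matrix {α : Fin n → ℕ // ∑ j, α j ≤ d - k} {β : Fin n → ℕ // ∑ j, β j ≤ k} ℂ :=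
  Matrix.of fun α β => ∑ i, lam i * ∏ j, z i j ^ (α.1 j + β.1 j)

/-- If `rank(Z_D) = s` (regularity at most `D`) then, for all `0 ≤ k ≤ d − D`,
`rank(Cat_k(φ)) = rank(Z_k)`. -/
theorem statement5 (n s d D : ℕ) (z : Fin s → Fin n → ℂ) (lam : Fin s → ℂ)
    (hlam : ∀ i, lam i ≠ 0)
    (hD : (vand n s z D).rank = s)
    (k : ℕ) (hk : k + D ≤ d) :
    (catOfPoints n s d z lam k).rank = (vand n s z k).rank := by
  classical
  have hcat : catOfPoints n s d z lam k =
      (vand n s z (d - k)).transpose * (Matrix.diagonal lam * vand n s z k) := by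
    ext α β
    rw [Matrix.mul_apply]
    simp only [catOfPoints, vand, Matrix.of_apply, Matrix.transpose_apply,
      Matrix.diagonal_mul, pow_add, Finset.prod_mul_distrib]
    exact Finset.sum_congr rfl fun i _ => by ring
  have hsurj : Function.Surjective (vand n s z D).mulVec := by
    have h : LinearMap.range (vand n s z D).mulVecLin = ⊤ := by
      apply Submodule.eq_top_of_finrank_eq
      rw [← Matrix.rank, hD]
      simp
    intro y
    obtain ⟨x, hx⟩ := LinearMap.range_eq_top.mp h y
    exact ⟨x, hx⟩
  obtain ⟨W, hW⟩ := Matrix.mulVec_surjective_iff_exists_right_inverse.mp hsurj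
  -- the rows with degree at most `D` are selected by a 0-1 matrix
  let P : Matrix {γ : Fin n → ℕ // ∑ j, γ j ≤ D} {γ : Fin n → ℕ // ∑ j, γ j ≤ d - k} ℂ :=
    Matrix.of fun a b => if b = ⟨a.1, a.2.trans (by omega)⟩ then 1 else 0
  have hP : P * (vand n s z (d - k)).transpose = (vand n s z D).transpose := by
    ext a i
    rw [Matrix.mul_apply, Finset.sum_eq_single ⟨a.1, a.2.trans (by omega)⟩]
    · simp [P, vand]
    · intro b _ hb
      simp [P, hb]
    · intro h
      exact absurd (Finset.mem_univ _) h
  have hl : Matrix.diagonal (fun i => (lam i)⁻¹) * Matrix.diagonal lam = 1 := by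
    rw [Matrix.diagonal_mul_diagonal, ← Matrix.diagonal_one]
    congr 1
    funext i
    exact inv_mul_cancel₀ (hlam i)
  have hW' : W.transpose * (vand n s z D).transpose = 1 := by
    rw [← Matrix.transpose_mul, hW, Matrix.transpose_one]
  have key : (Matrix.diagonal (fun i => (lam i)⁻¹) * (W.transpose * P)) *
      catOfPoints n s d z lam k = vand n s z k := by
    rw [hcat]
    calc _ = Matrix.diagonal (fun i => (lam i)⁻¹) * ((W.transpose *
          (P * (vand n s z (d - k)).transpose)) * (Matrix.diagonal lam * vand n s z k)) := by
          simp only [Matrix.mul_assoc]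
      _ = _ := by rw [hP, hW', Matrix.one_mul, ← Matrix.mul_assoc, hl, Matrix.one_mul]
  apply le_antisymm
  · rw [hcat, ← Matrix.mul_assoc]
    exact Matrix.rank_mul_le_right _ _
  · conv_lhs => rw [← key]
    exact Matrix.rank_mul_le_right _ _
end

section
/- Let d ≥ 1 and let φ : {γ ∈ ℕ² : |γ| = d} → ℂ be a symmetric binary tensor of order d. Call a tuple z_1, …, z_s ∈ ℂ² a size-s decomposition of φ if φ_γ = Σ_{i=1}^s z_i^γ for all γ with |γ| = d, and let r (the Waring rank of φ) be the minimum s for which a size-s decomposition exists. Then for every s with r+1 ≤ s ≤ d−r+1 there is no size-s decomposition of φ consisting of nonzero, pairwise linearly independent vectors z_1, …, z_s ∈ ℂ². -/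
open scoped BigOperators

/-- `z 1, …, z s` give a size-`s` decomposition of the order-`d` binary tensor `φ`. -/
def isDecomp (d s : ℕ) (φ : (Fin 2 → ℕ) → ℂ) (z : Fin s → Fin 2 → ℂ) : Prop :=
  ∀ γ : Fin 2 → ℕ, (∑ j, γ j = d) → φ γ = ∑ i, ∏ j, z i j ^ γ j

/-- A linear form vanishing on `w` but not on `z`. -/
lemma exists_form (z w : Fin 2 → ℂ) (hz : z ≠ 0) (h : ∀ c : ℂ, z ≠ c • w) :
    ∃ p : ℂ × ℂ, p.1 * w 0 + p.2 * w 1 = 0 ∧ p.1 * z 0 + p.2 * z 1 ≠ 0 := by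
  by_cases hw : w = 0
  · subst hw
    by_cases h0 : z 0 = 0
    · refine ⟨(0, 1), by simp, ?_⟩
      intro h1
      apply hz
      ext j
      fin_cases j
      · simpa using h0
      · simpa using h1
    · exact ⟨(1, 0), by simp, by simpa using h0⟩
  · refine ⟨(w 1, - w 0), by ring, ?_⟩
    intro hdet
    simp only at hdet
    by_cases h0 : w 0 = 0
    · have h1 : w 1 ≠ 0 := by
        intro h1
        apply hw
        ext j
        fin_cases j
        · simpa using h0
        · simpa using h1
      apply h (z 1 / w 1)
      ext j
      fin_cases j
      · have : z 0 = 0 := by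
          rw [h0] at hdet
          simpa [h1] using hdet
        simp [h0, this]
      · simp [h1]
    · apply h (z 0 / w 0)
      ext j
      fin_cases j
      · simp [h0]
      · simp only [Fin.mk_one, Pi.smul_apply, smul_eq_mul]
        field_simp
        linear_combination -hdet

lemma forms_agree (d s r : ℕ) (φ : (Fin 2 → ℕ) → ℂ) (z : Fin s → Fin 2 → ℂ)
    (w : Fin r → Fin 2 → ℂ) (hz : isDecomp d s φ z) (hw : isDecomp d r φ w)
    (L : List (ℂ × ℂ)) : ∀ a b : ℕ, L.length + a + b = d →
    ∑ i, (L.map (fun p => p.1 * z i 0 + p.2 * z i 1)).prod * (z i 0 ^ a * z i 1 ^ b) =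
    ∑ i, (L.map (fun p => p.1 * w i 0 + p.2 * w i 1)).prod * (w i 0 ^ a * w i 1 ^ b) := by
  induction L with
  | nil =>
    intro a b hab
    have h1 := hz ![a, b] (by simpa using hab)
    have h2 := hw ![a, b] (by simpa using hab)
    rw [h1] at h2
    simpa using h2
  | cons p L ih =>
    intro a b hab
    simp only [List.length_cons] at hab
    have h1 := ih (a + 1) b (by omega)
    have h2 := ih a (b + 1) (by omega)
    have key : ∀ (n : ℕ) (v : Fin n → Fin 2 → ℂ),
        ∑ i, ((p :: L).map (fun p => p.1 * v i 0 + p.2 * v i 1)).prod *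
          (v i 0 ^ a * v i 1 ^ b) =
        p.1 * ∑ i, (L.map (fun p => p.1 * v i 0 + p.2 * v i 1)).prod *
          (v i 0 ^ (a + 1) * v i 1 ^ b) +
        p.2 * ∑ i, (L.map (fun p => p.1 * v i 0 + p.2 * v i 1)).prod *
          (v i 0 ^ a * v i 1 ^ (b + 1)) := by
      intro n v
      rw [Finset.mul_sum, Finset.mul_sum, ← Finset.sum_add_distrib]
      refine Finset.sum_congr rfl fun i _ => ?_
      rw [List.map_cons, List.prod_cons]
      ring
    rw [key, key, h1, h2]

/-- For a binary tensor of Waring rank `r`, there are no decompositions of size `s`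
(into nonzero, pairwise linearly independent vectors) for `r+1 ≤ s ≤ d−r+1`. -/
theorem statement6 (d : ℕ) (hd : 1 ≤ d) (φ : (Fin 2 → ℕ) → ℂ) (r : ℕ)
    (hr : IsLeast {s : ℕ | ∃ z : Fin s → Fin 2 → ℂ, isDecomp d s φ z} r)
    (s : ℕ) (hs1 : r + 1 ≤ s) (hs2 : s + r ≤ d + 1) :
    ¬ ∃ z : Fin s → Fin 2 → ℂ,
        (∀ i, z i ≠ 0) ∧
        (∀ i i' : Fin s, i ≠ i' → ∀ c : ℂ, z i ≠ c • z i') ∧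
        isDecomp d s φ z := by
  rintro ⟨z, hz0, hzi, hz⟩
  obtain ⟨⟨w, hw⟩, -⟩ := hr
  have hex : ∃ i0, ∀ j, ∀ c : ℂ, z i0 ≠ c • w j := by
    by_contra! hcon
    choose f c hf using hcon
    have hinj : Function.Injective f := by
      intro i i' hii
      by_contra hne
      have hc : c i' ≠ 0 := by
        intro hc
        apply hz0 i'
        rw [hf i', hc, zero_smul]
      apply hzi i i' hne (c i / c i')
      rw [hf i', smul_smul, div_mul_cancel₀ _ hc, ← hii]
      exact hf i
    have := Fintype.card_le_of_injective f hinj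
    simp at this
    omega
  obtain ⟨i0, hi0⟩ := hex
  choose g hg1 hg2 using fun j => exists_form (z i0) (w j) (hz0 i0) (hi0 j)
  have hk : ∀ i, ∃ p : ℂ × ℂ, i ≠ i0 →
      p.1 * z i 0 + p.2 * z i 1 = 0 ∧ p.1 * z i0 0 + p.2 * z i0 1 ≠ 0 := by
    intro i
    by_cases hi : i = i0
    · exact ⟨0, fun h => absurd hi h⟩
    · obtain ⟨p, hp⟩ := exists_form (z i0) (z i) (hz0 i0) (hzi i0 i (Ne.symm hi))
      exact ⟨p, fun _ => hp⟩
  choose k hk using hk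
  obtain ⟨l, -, hl⟩ := exists_form (z i0) 0 (hz0 i0) (by simpa using hz0 i0)
  let L : List (ℂ × ℂ) := (Finset.univ.erase i0).toList.map k ++
    ((Finset.univ : Finset (Fin r)).toList.map g ++ List.replicate (d - (s - 1 + r)) l)
  have hL : L.length + 0 + 0 = d := by
    simp [L]
    omega
  have H := forms_agree d s r φ z w hz hw L 0 0 hL
  have hR : ∀ j, (L.map (fun p => p.1 * w j 0 + p.2 * w j 1)).prod = 0 := by
    intro j
    apply List.prod_eq_zero
    rw [List.mem_map]
    exact ⟨g j, by simp [L], hg1 j⟩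
  have hZ : ∀ i, i ≠ i0 → (L.map (fun p => p.1 * z i 0 + p.2 * z i 1)).prod = 0 := by
    intro i hi
    apply List.prod_eq_zero
    rw [List.mem_map]
    refine ⟨k i, ?_, (hk i hi).1⟩
    simp only [L, List.mem_append, List.mem_map]
    exact Or.inl ⟨i, by simpa using hi, rfl⟩
  have hN : (L.map (fun p => p.1 * z i0 0 + p.2 * z i0 1)).prod ≠ 0 := by
    apply List.prod_ne_zero
    intro hmem
    rw [List.mem_map] at hmem
    obtain ⟨p, hp, hp0⟩ := hmem
    simp only [L, List.mem_append, List.mem_map] at hp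
    rcases hp with ⟨i, hi, rfl⟩ | ⟨j, -, rfl⟩ | hp
    · exact (hk i (by simpa using hi)).2 hp0
    · exact hg2 j hp0
    · rw [List.eq_of_mem_replicate hp] at hp0
      exact hl hp0
  rw [Finset.sum_eq_single i0 (fun i _ hi => by rw [hZ i hi, zero_mul]) (by simp),
    Finset.sum_eq_zero (fun j _ => by rw [hR j, zero_mul])] at H
  simp only [pow_zero, mul_one] at H
  exact hN H
end

section
/- Let d ≥ 2, n ≥ 1, and let φ : {γ ∈ ℕ^{n+1} : |γ| = d} → ℂ be a symmetric tensor whose Waring rank is r, i.e., r is the least s for which there exist w_1,…,w_s ∈ ℂ^{n+1} with φ_γ = Σ_{i=1}^s w_i^γ for all |γ| = d; assume that some rank-r decomposition w_1,…,w_r satisfies w_{i,0} ≠ 0 for every i. Define the dehomogenized entries φ̂_α := φ_{(d−|α|,α)} for α ∈ ℕ^n with |α| ≤ d, and for 0 ≤ k ≤ d let Cat_k be the matrix (φ̂_{α+β}) with rows |α| ≤ d−k and columns |β| ≤ k. If rank(Cat_{⌊d/2⌋}) = r, then there exists a finite set B ⊆ ℕ^n connected to 1 with |B| = r and max_{α ∈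 B} |α| ≤ ⌊d/2⌋ such that the r × r matrix (φ̂_{α+β})_{α,β ∈ B} is invertible; moreover B can be chosen so that max_{α ∈ B} |α| equals the least k with rank(Cat_k) = r. -/
open scoped BigOperators

/-- The `k`-th catalecticant matrix of the dehomogenized tensor `φ̂`:
rows indexed by `|α| ≤ d−k`, columns by `|β| ≤ k`, entries `φ̂_{α+β}`. -/
noncomputable def catM (n d : ℕ) (φh : (Fin n → ℕ) → ℂ) (k : ℕ) :
    Matrix {α : Fin n → ℕ // ∑ j, α j ≤ d - k} {β : Fin n → ℕ // ∑ j, β j ≤ k} ℂ :=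
  Matrix.of fun α β => φh (α.1 + β.1)

/-- The dehomogenization `φ̂_α = φ_{(d−|α|, α)}` of an order-`d` tensor `φ`. -/
noncomputable def dehom (n d : ℕ) (φ : (Fin (n+1) → ℕ) → ℂ) : (Fin n → ℕ) → ℂ :=
  fun α => φ (Fin.cons (d - ∑ j, α j) α)

/-- Monomial evaluation vectors. -/
noncomputable def evV {n r : ℕ} (z : Fin r → Fin n → ℂ) (α : Fin n → ℕ) : Fin r → ℂ :=
  fun i => ∏ j, z i j ^ α j

lemma evV_step {n r : ℕ} (z : Fin r → Fin n → ℂ) (α : Fin n → ℕ) (j : Fin n) :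
    evV z (α + Pi.single j 1) = fun i => z i j * evV z α i := by
  funext i
  simp only [evV, Pi.add_apply, pow_add, Finset.prod_mul_distrib]
  rw [mul_comm]
  congr 1
  rw [Finset.prod_eq_single j]
  · simp
  · intro b _ hb
    simp [hb]
  · simp

/-- Degree-by-degree construction of a connected basis. -/
lemma exists_conn {n r : ℕ} (z : Fin r → Fin n → ℂ) (k : ℕ) :
    ∃ B : Set (Fin n → ℕ),
      (∀ α ∈ B, α = 0 ∨ ∃ α' ∈ B, ∃ i : Fin n, α = α' + Pi.single i 1) ∧
      (∀ α ∈ B, ∑ j, α j ≤ k) ∧ LinearIndepOn ℂ (evV z) B ∧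
      ∀ α : Fin n → ℕ, ∑ j, α j ≤ k → evV z α ∈ Submodule.span ℂ (evV z '' B) := by
  induction k with
  | zero =>
    obtain ⟨b, hb, -, hs, hl⟩ := exists_linearIndepOn_extension
      (linearIndepOn_empty ℂ (evV z)) (Set.empty_subset {(0 : Fin n → ℕ)})
    refine ⟨b, fun α h => Or.inl (hb h), fun α h => ?_, hl, fun α h => ?_⟩
    · have := hb h
      simp only [Set.mem_singleton_iff] at this
      simp [this]
    · have : α = 0 := by
        funext j
        simp at h
        simpa using h j
      subst this
      exact hs ⟨0, rfl, rfl⟩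
  | succ k ih =>
    obtain ⟨B, hc, hd, hl, hs⟩ := ih
    obtain ⟨b, hb, hBb, hsp, hl'⟩ := exists_linearIndepOn_extension hl
      (Set.subset_union_left (t := {α | ∃ α' ∈ B, ∃ i : Fin n, α = α' + Pi.single i 1}))
    refine ⟨b, fun α h => ?_, fun α h => ?_, hl', fun α h => ?_⟩
    · rcases hb h with h | ⟨α', h1, i, h2⟩
      · rcases hc α h with h | ⟨α', h1, i, h2⟩
        · exact Or.inl h
        · exact Or.inr ⟨α', hBb h1, i, h2⟩
      · exact Or.inr ⟨α', hBb h1, i, h2⟩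
    · rcases hb h with h | ⟨α', h1, i, h2⟩
      · exact (hd α h).trans (Nat.le_succ k)
      · have := hd α' h1
        subst h2
        simp [Finset.sum_add_distrib, this]
    · by_cases hα : ∑ j, α j ≤ k
      · exact Submodule.span_mono (Set.image_mono hBb) (hs α hα)
      · obtain ⟨j, hj⟩ : ∃ j, α j ≠ 0 := by
          by_contra hcon
          push Not at hcon
          simp [hcon] at hα
        obtain ⟨α', rfl⟩ : ∃ α' : Fin n → ℕ, α = α' + Pi.single j 1 := by
          refine ⟨α - Pi.single j 1, ?_⟩
          funext i
          by_cases hi : i = j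
          · subst hi
            simp
            omega
          · simp [hi]
        have h' : ∑ j, α' j ≤ k := by
          simp [Finset.sum_add_distrib] at h
          exact h
        let L : (Fin r → ℂ) →ₗ[ℂ] (Fin r → ℂ) :=
          { toFun := fun u i => z i j * u i
            map_add' := by intro u v; funext i; simp [mul_add]
            map_smul' := by intro u v; funext i; simp [mul_left_comm] }
        have hL : evV z (α' + Pi.single j 1) = L (evV z α') := evV_step z α' j
        rw [hL]
        have := Submodule.mem_map_of_mem (f := L) (hs α' h')
        rw [Submodule.map_span] at this
        refine Submodule.span_le.2 ?_ this
        rintro _ ⟨_, ⟨β, hβ, rfl⟩, rfl⟩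
        have hL' : evV z (β + Pi.single j 1) = L (evV z β) := evV_step z β j
        rw [← hL']
        exact hsp ⟨_, Or.inr ⟨β, hβ, j, rfl⟩, rfl⟩

/-- Evaluation matrix in degree at most `k`. -/
noncomputable def evM {n r : ℕ} (z : Fin r → Fin n → ℂ) (k : ℕ) :
    Matrix (Fin r) {α : Fin n → ℕ // ∑ j, α j ≤ k} ℂ := Matrix.of fun i α => evV z α.1 i

/-- Span of evaluation vectors of degree at most `k`. -/
noncomputable def spV {n r : ℕ} (z : Fin r → Fin n → ℂ) (k : ℕ) : Submodule ℂ (Fin r → ℂ) :=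
  Submodule.span ℂ (evV z '' {α | ∑ j, α j ≤ k})

lemma range_evM {n r : ℕ} (z : Fin r → Fin n → ℂ) (k : ℕ) :
    LinearMap.range (evM z k).mulVecLin = spV z k := by
  rw [Matrix.range_mulVecLin, spV]
  congr 1
  ext u
  constructor
  · rintro ⟨α, rfl⟩
    exact ⟨α.1, α.2, rfl⟩
  · rintro ⟨α, h, rfl⟩
    exact ⟨⟨α, h⟩, rfl⟩

lemma rank_evM {n r : ℕ} (z : Fin r → Fin n → ℂ) (k : ℕ) :
    (evM z k).rank = r ↔ spV z k = ⊤ := by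
  rw [Matrix.rank, range_evM]
  constructor
  · intro h
    exact Submodule.eq_top_of_finrank_eq (by simp [h])
  · intro h
    rw [h, finrank_top, Module.finrank_fin_fun]

lemma dehom_eq {n d r : ℕ} {φ : (Fin (n+1) → ℕ) → ℂ} {w : Fin r → Fin (n+1) → ℂ}
    (hw : ∀ γ : Fin (n+1) → ℕ, (∑ j, γ j = d) → φ γ = ∑ i, ∏ j, w i j ^ γ j)
    (h0 : ∀ i, w i 0 ≠ 0) (α β : Fin n → ℕ) (h : ∑ j, α j + ∑ j, β j ≤ d) :
    dehom n d φ (α + β) = ∑ i, evV (fun i j => w i j.succ / w i 0) α i *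
      (w i 0 ^ d * evV (fun i j => w i j.succ / w i 0) β i) := by
  have hs : ∑ j, (α + β) j = ∑ j, α j + ∑ j, β j := by simp [Finset.sum_add_distrib]
  rw [dehom, hw _ (by rw [Fin.sum_univ_succ]; simp only [Fin.cons_zero, Fin.cons_succ]; omega)]
  refine Finset.sum_congr rfl fun i _ => ?_
  rw [Fin.prod_univ_succ]
  simp only [Fin.cons_zero, Fin.cons_succ, evV, div_pow, Finset.prod_div_distrib,
    Finset.prod_pow_eq_pow_sum, Pi.add_apply, pow_add, Finset.prod_mul_distrib]
  have hs' : ∑ j, (α j + β j) = ∑ j, α j + ∑ j, β j := Finset.sum_add_distrib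
  rw [hs']
  have : w i 0 ^ d = w i 0 ^ (d - (∑ j, α j + ∑ j, β j)) * (w i 0 ^ (∑ j, α j) * w i 0 ^ (∑ j, β j)) := by
    rw [← pow_add, ← pow_add]
    congr 1
    omega
  rw [this]
  have := h0 i
  field_simp

lemma catM_eq {n d r : ℕ} {φ : (Fin (n+1) → ℕ) → ℂ} {w : Fin r → Fin (n+1) → ℂ}
    (hw : ∀ γ : Fin (n+1) → ℕ, (∑ j, γ j = d) → φ γ = ∑ i, ∏ j, w i j ^ γ j)
    (h0 : ∀ i, w i 0 ≠ 0) (k : ℕ) (hk : k ≤ d) :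
    catM n d (dehom n d φ) k = (evM (fun i j => w i j.succ / w i 0) (d - k)).transpose *
      Matrix.diagonal (fun i => w i 0 ^ d) * evM (fun i j => w i j.succ / w i 0) k := by
  ext α β
  rw [Matrix.mul_assoc, Matrix.mul_apply]
  simp only [catM, Matrix.of_apply, Matrix.diagonal_mul, Matrix.transpose_apply, evM]
  have := α.2
  have := β.2
  exact dehom_eq hw h0 _ _ (by omega)

lemma spV_mono {n r : ℕ} (z : Fin r → Fin n → ℂ) {k l : ℕ} (h : k ≤ l) : spV z k ≤ spV z l :=
  Submodule.span_mono (Set.image_mono fun _ h' => le_trans h' h)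

lemma catM_rank {n d r : ℕ} {φ : (Fin (n+1) → ℕ) → ℂ} {w : Fin r → Fin (n+1) → ℂ}
    (hw : ∀ γ : Fin (n+1) → ℕ, (∑ j, γ j = d) → φ γ = ∑ i, ∏ j, w i j ^ γ j)
    (h0 : ∀ i, w i 0 ≠ 0) (k : ℕ) (hk : k ≤ d)
    (h : (catM n d (dehom n d φ) k).rank = r) : spV (fun i j => w i j.succ / w i 0) k = ⊤ := by
  rw [← rank_evM]
  apply le_antisymm
  · simpa using Matrix.rank_le_card_height (evM (fun i j => w i j.succ / w i 0) k)
  · rw [catM_eq hw h0 k hk] at h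
    exact h.symm.le.trans (Matrix.rank_mul_le_right _ _)

lemma rank_catM {n d r : ℕ} {φ : (Fin (n+1) → ℕ) → ℂ} {w : Fin r → Fin (n+1) → ℂ}
    (hw : ∀ γ : Fin (n+1) → ℕ, (∑ j, γ j = d) → φ γ = ∑ i, ∏ j, w i j ^ γ j)
    (h0 : ∀ i, w i 0 ≠ 0) (k : ℕ) (hk : k ≤ d / 2)
    (h : spV (fun i j => w i j.succ / w i 0) k = ⊤) :
    (catM n d (dehom n d φ) k).rank = r := by
  rw [catM_eq hw h0 k (by omega), Matrix.rank, Matrix.mulVecLin_mul,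
    LinearMap.range_comp_of_range_eq_top _ (by rw [range_evM, h]), ← Matrix.rank,
    Matrix.rank_mul_eq_left_of_isUnit_det, Matrix.rank_transpose, rank_evM]
  · exact top_le_iff.1 (h ▸ spV_mono _ (by omega))
  · rw [Matrix.det_diagonal, isUnit_iff_ne_zero, Finset.prod_ne_zero_iff]
    exact fun i _ => pow_ne_zero _ (h0 i)

/-- If the Waring rank of `φ` is `r`, some rank-`r` decomposition avoids the hyperplane
`x_0 = 0`, and `rank(Cat_{⌊d/2⌋}) = r`, then there is a monomial set `B` connected to `1`,
of cardinality `r` and degree at most `⌊d/2⌋`, whose Hankel block `(φ̂_{α+β})_{α,β∈B}`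
is invertible; moreover `B` can be chosen with maximal degree equal to the least `k`
with `rank(Cat_k) = r`. -/
theorem statement7 (n d : ℕ) (hn : 1 ≤ n) (hd : 2 ≤ d)
    (φ : (Fin (n+1) → ℕ) → ℂ) (r : ℕ)
    (hr : IsLeast {s : ℕ | ∃ w : Fin s → Fin (n+1) → ℂ,
      ∀ γ : Fin (n+1) → ℕ, (∑ j, γ j = d) → φ γ = ∑ i, ∏ j, w i j ^ γ j} r)
    (hdehom : ∃ w : Fin r → Fin (n+1) → ℂ,
      (∀ γ : Fin (n+1) → ℕ, (∑ j, γ j = d) → φ γ = ∑ i, ∏ j, w i j ^ γ j) ∧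
      ∀ i, w i 0 ≠ 0)
    (hcat : (catM n d (dehom n d φ) (d / 2)).rank = r) :
    ∃ B : Finset (Fin n → ℕ),
      (∀ α ∈ B, α = 0 ∨ ∃ α' ∈ B, ∃ i : Fin n, α = α' + Pi.single i 1) ∧
      B.card = r ∧
      (∀ α ∈ B, ∑ j, α j ≤ d / 2) ∧
      (Matrix.of fun a b : {x // x ∈ B} => dehom n d φ (a.1 + b.1)).det ≠ 0 ∧
      IsLeast {k : ℕ | (catM n d (dehom n d φ) k).rank = r}
        (B.sup fun α => ∑ j, α j) := by
  classical
  obtain ⟨w, hw, h0⟩ := hdehom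
  set z : Fin r → Fin n → ℂ := fun i j => w i j.succ / w i 0 with hz
  have hsp := catM_rank hw h0 (d / 2) (by omega) hcat
  have hex : ∃ k, spV z k = ⊤ := ⟨d / 2, hsp⟩
  have hk0 : Nat.find hex ≤ d / 2 := Nat.find_min' hex hsp
  have hktop := Nat.find_spec hex
  set k0 := Nat.find hex with hk0def
  obtain ⟨B', hc, hdeg, hl, hs⟩ := exists_conn z k0
  have hfin : B'.Finite := (finiteDegLe n k0).subset hdeg
  obtain ⟨B, rfl⟩ := hfin.exists_finset_coe
  simp only [Finset.mem_coe] at hc hdeg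
  have hBtop : Submodule.span ℂ (evV z '' (B : Set (Fin n → ℕ))) = ⊤ := by
    rw [← top_le_iff, ← hktop, spV, Submodule.span_le]
    rintro _ ⟨α, hα, rfl⟩
    exact hs α hα
  have hBtop' : Submodule.span ℂ (Set.range fun x : {x // x ∈ B} => evV z x.1) = ⊤ := by
    rw [← hBtop]
    congr 1
    ext u
    simp
  have hli : LinearIndependent ℂ (fun x : {x // x ∈ B} => evV z x.1) := hl
  have hsup : (B.sup fun α => ∑ j, α j) ≤ k0 := Finset.sup_le hdeg
  refine ⟨B, hc, ?_, fun α h => (hdeg α h).trans hk0, ?_, ?_, ?_⟩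
  · have := finrank_span_eq_card hli
    rw [hBtop'] at this
    simpa using this.symm
  · intro hdet
    obtain ⟨c, hc0, hcM⟩ := Matrix.exists_mulVec_eq_zero_iff.2 hdet
    apply hc0
    set y : Fin r → ℂ := ∑ b, c b • evV z b.1 with hy
    have key : ∀ a : {x // x ∈ B}, ∑ i, evV z a.1 i * (w i 0 ^ d * y i) = 0 := by
      intro a
      have h1 := congrFun hcM a
      simp only [Matrix.mulVec, dotProduct, Matrix.of_apply, Pi.zero_apply] at h1
      rw [← h1]
      have : ∀ b : {x // x ∈ B}, dehom n d φ (a.1 + b.1) * c b =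
          ∑ i, evV z a.1 i * (w i 0 ^ d * evV z b.1 i) * c b := by
        intro b
        have h2 := hdeg a.1 a.2
        have h3 := hdeg b.1 b.2
        rw [dehom_eq hw h0 _ _ (by omega), Finset.sum_mul]
      rw [Finset.sum_congr rfl fun b _ => this b, Finset.sum_comm]
      refine Finset.sum_congr rfl fun i _ => ?_
      simp only [hy, Finset.sum_apply, Pi.smul_apply, smul_eq_mul, Finset.mul_sum]
      refine Finset.sum_congr rfl fun b _ => ?_
      ring
    let F : (Fin r → ℂ) →ₗ[ℂ] ℂ := ∑ i, (w i 0 ^ d * y i) • LinearMap.proj i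
    have hF : ∀ u, F u = ∑ i, u i * (w i 0 ^ d * y i) := by
      intro u
      simp [F, mul_comm]
    have hF0 : F = 0 := by
      refine LinearMap.ext_on_range hBtop' fun a => ?_
      rw [hF, key a]
      rfl
    have hy0 : y = 0 := by
      funext i
      have := hF (Pi.single i 1)
      rw [hF0] at this
      simp [Pi.single_apply] at this
      rcases this with h | h
      · exact absurd h.1 (h0 i)
      · exact h
    funext b
    exact Fintype.linearIndependent_iff.1 hli c (hy ▸ hy0) b
  · refine rank_catM hw h0 _ (hsup.trans hk0) ?_
    rw [← top_le_iff, ← hBtop]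
    refine Submodule.span_mono (Set.image_mono fun α hα => ?_)
    exact Finset.le_sup (f := fun α : Fin n → ℕ => ∑ j, α j) hα
  · intro k hk
    by_cases hkd : k ≤ d / 2
    · exact hsup.trans (Nat.find_min' hex (catM_rank hw h0 k (by omega) hk))
    · omega
end

section
/- Let n ≥ 1 and 1 ≤ c ≤ n. Let B₂ := {γ ∈ ℕ^n : |γ| = 2 and Σ_{j=1}^c γ_j ≥ 1} (the degree-2 part of the set of the first r = Σ_{j=0}^c (n−j+1) exponent vectors in graded lexicographic order). Then the set of pairs { (α+e_i, β+e_j) : α ∈ B₂, β ∈ {e_1,…,e_n}, i ≠ j, β+e_j ∉ B₂, β+e_i ∈ B₂ } equals the set { (η, θ) ∈ ℕ^n × ℕ^n : |η| = 3, |θ| = 2, Σ_{j=1}^c η_j ≥ 2, Σ_{j=1}^c θ_j = 0 }. -/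
open scoped BigOperators

/-- The sum `γ_𝒞 = Σ_{j=1}^c γ_j` of the first `c` coordinates of a multi-index. -/
def csum (n c : ℕ) (γ : Fin n → ℕ) : ℕ :=
  ∑ j ∈ Finset.univ.filter (fun j : Fin n => (j : ℕ) < c), γ j

/-- The degree-2 part `B₂` of the set of the first `r = Σ_{j=0}^c (n−j+1)` exponent
vectors in graded lexicographic order. -/
def B2 (n c : ℕ) : Set (Fin n → ℕ) :=
  {γ | (∑ j, γ j = 2) ∧ 1 ≤ csum n c γ}

theorem csum_add' (n c : ℕ) (a b : Fin n → ℕ) : csum n c (a + b) = csum n c a + csum n c b := by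
  simp [csum, Finset.sum_add_distrib]

theorem csum_single' (n c : ℕ) (i : Fin n) :
    csum n c (Pi.single i 1) = if (i : ℕ) < c then 1 else 0 := by
  simp [csum, Finset.sum_pi_single]

theorem tot_add' (n : ℕ) (a b : Fin n → ℕ) : ∑ t, (a + b) t = ∑ t, a t + ∑ t, b t := by
  simp [Finset.sum_add_distrib]

theorem tot_single' (n : ℕ) (i : Fin n) : ∑ t, (Pi.single i 1 : Fin n → ℕ) t = 1 := by
  simp

theorem split' (n : ℕ) (a : Fin n → ℕ) (i : Fin n) (h : a i ≠ 0) :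
    ∃ b : Fin n → ℕ, a = b + Pi.single i 1 := by
  refine ⟨a - Pi.single i 1, ?_⟩
  ext t
  by_cases ht : t = i
  · subst ht
    simp
    omega
  · simp [ht]

theorem exists_split' (n : ℕ) (a : Fin n → ℕ) (h : ∑ t, a t ≠ 0) :
    ∃ (b : Fin n → ℕ) (i : Fin n), a = b + Pi.single i 1 := by
  obtain ⟨i, -, hi⟩ := Finset.exists_ne_zero_of_sum_ne_zero h
  obtain ⟨b, hb⟩ := split' n a i hi
  exact ⟨b, i, hb⟩

theorem exists_csplit' (n c : ℕ) (a : Fin n → ℕ) (h : csum n c a ≠ 0) :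
    ∃ (b : Fin n → ℕ) (i : Fin n), (i : ℕ) < c ∧ a = b + Pi.single i 1 := by
  obtain ⟨i, hm, hi⟩ := Finset.exists_ne_zero_of_sum_ne_zero h
  obtain ⟨b, hb⟩ := split' n a i hi
  exact ⟨b, i, by simpa using hm, hb⟩

/-- Description of the index set `E₁` of the linear determinantal relations:
it equals the set of pairs `(η, θ)` with `|η| = 3`, `|θ| = 2`, `η_𝒞 ≥ 2`, `θ_𝒞 = 0`. -/
theorem statement9 (n c : ℕ) (hn : 1 ≤ n) (hc1 : 1 ≤ c) (hcn : c ≤ n) :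
    {q : (Fin n → ℕ) × (Fin n → ℕ) |
        ∃ α ∈ B2 n c, ∃ b i j : Fin n, i ≠ j ∧
          Pi.single b 1 + Pi.single j 1 ∉ B2 n c ∧
          Pi.single b 1 + Pi.single i 1 ∈ B2 n c ∧
          q = (α + Pi.single i 1, Pi.single b 1 + Pi.single j 1)}
      = {q : (Fin n → ℕ) × (Fin n → ℕ) |
          (∑ t, q.1 t = 3) ∧ (∑ t, q.2 t = 2) ∧ 2 ≤ csum n c q.1 ∧ csum n c q.2 = 0} := by
  ext ⟨η, θ⟩
  simp only [Set.mem_setOf_eq, B2, Prod.mk.injEq]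
  constructor
  · rintro ⟨α, ⟨h1, h2⟩, b, i, j, hij, hn1, ⟨-, h3⟩, rfl, rfl⟩
    simp only [tot_add', tot_single', csum_add', csum_single'] at *
    grind
  · rintro ⟨h1, h2, h3, h4⟩
    obtain ⟨α, i, hi, rfl⟩ := exists_csplit' n c η (by omega)
    obtain ⟨θ', j, rfl⟩ := exists_split' n θ (by omega)
    rw [tot_add', tot_single'] at h1 h2
    obtain ⟨θ'', b, rfl⟩ := exists_split' n θ' (by omega)
    rw [tot_add', tot_single'] at h2
    have h0 : θ'' = 0 := by
      have : ∑ t, θ'' t = 0 := by omega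
      ext t
      simpa using (Finset.sum_eq_zero_iff.mp this) t (Finset.mem_univ t)
    subst h0
    simp only [csum_add', csum_single', zero_add] at h3 h4
    refine ⟨α, ⟨by omega, by grind⟩, b, i, j, ?_, ?_, ?_, rfl, by simp⟩
    · rintro rfl
      grind
    · simp only [tot_add', tot_single', csum_add', csum_single']
      omega
    · simp only [tot_add', tot_single', csum_add', csum_single']
      grind
end

section
/- Let n ≥ 2 and r = 2n+1. Define points p_1, …, p_r ∈ ℂ^n by: p_1 = 0; p_k = e_{k−1} for 2 ≤ k ≤ n+1; and for n+2 ≤ k ≤ 2n+1, (p_k)_j = −1 for 1 ≤ j ≤ k−(n+1) and (p_k)_j = 2 for k−(n+1) < j ≤ n. Let B := {0, e_1, …, e_n, 2e_1, e_1+e_2, …, e_1+e_n} ⊂ ℕ^n, and for a finite set S ⊂ ℕ^n with |S| = r let Z_S be the r × r matrix whose columns, taken in graded lexicographic order of S, have entries p_i^α for α ∈ S. Set m := det(Z_B) and m_γ^δ := det(Z_{(B∖{γ})∪{δ}}). Then: (i) m = 2·3^{n−1}; (ii) m_{2e_1}^{e_j+e_k} = (−1)^{n+1}·m for all 2 ≤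 j ≤ k ≤ n; (iii) m_{e_1+e_j}^{e_j+e_k} = (−1)^{n+j+1}·2m for all 2 ≤ j < k ≤ n; (iv) m_{e_1+e_k}^{e_j+e_k} = (−1)^{n+k}·m for all 2 ≤ j < k ≤ n; (v) m_{e_1+e_i}^{e_j+e_k} = 0 for all other choices with 2 ≤ i ≤ n and 2 ≤ j ≤ k ≤ n (namely whenever j = k, or j < k with i ∉ {j,k}). -/
open scoped BigOperators

noncomputable section

/-- The specialized points (1-indexed `k ∈ {1,…,2n+1}`, here 0-indexed):
`p₁ = 0`, `p_k = e_{k−1}` for `2 ≤ k ≤ n+1`, and for `n+2 ≤ k ≤ 2n+1` the point with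
`−1` in the first `k−(n+1)` coordinates and `2` in the remaining ones. -/
def pts (n : ℕ) : Fin (2*n+1) → Fin n → ℂ := fun k j =>
  if (k : ℕ) = 0 then 0
  else if (k : ℕ) ≤ n then (if (j : ℕ) + 1 = (k : ℕ) then 1 else 0)
  else if (j : ℕ) + n + 1 ≤ (k : ℕ) then -1 else 2

/-- The `c`-th element (0-indexed) of
`B = {1, x₁, …, x_n, x₁², x₁x₂, …, x₁x_n}` in graded lexicographic order. -/
def colB (n : ℕ) (c : ℕ) : Fin n → ℕ := fun j =>
  if c = 0 then 0
  else if c ≤ n then (if (j : ℕ) + 1 = c then 1 else 0)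
  else if c = n + 1 then (if (j : ℕ) = 0 then 2 else 0)
  else (if (j : ℕ) = 0 then 1 else 0) + (if (j : ℕ) + n + 1 = c then 1 else 0)

/-- The Vandermonde matrix `Z_B` of the points, columns in graded lex order. -/
def ZB (n : ℕ) : Matrix (Fin (2*n+1)) (Fin (2*n+1)) ℂ :=
  Matrix.of fun i c => ∏ j, pts n i j ^ colB n (c : ℕ) j

/-- The columns of `Z_{(B∖{γ})∪{δ}}` in graded lex order, where `γ` sits at
position `p ∈ {n+1,…,2n}` of `B` and `δ` is a degree-2 vector in `x₂,…,x_n`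
(hence comes last in graded lex order). -/
def colMod (n : ℕ) (p : ℕ) (δ : Fin n → ℕ) (c : ℕ) : Fin n → ℕ :=
  if c = 2*n then δ else if c < p then colB n c else colB n (c+1)

/-- The Vandermonde matrix `Z_{(B∖{γ})∪{δ}}`, with `γ` at position `p` of `B`. -/
def Zmod (n : ℕ) (p : ℕ) (δ : Fin n → ℕ) : Matrix (Fin (2*n+1)) (Fin (2*n+1)) ℂ :=
  Matrix.of fun i c => ∏ j, pts n i j ^ colMod n p δ (c : ℕ) j

/-- The standard unit multi-index `e_j` (1-indexed `j`). -/
def eVec (n : ℕ) (j : ℕ) : Fin n → ℕ := fun t => if (t : ℕ) + 1 = j then 1 else 0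

/-- Value of the point `i` at coordinate `j` (1-indexed coordinate, natural number indices). -/
def xv (n i j : ℕ) : ℂ :=
  if i = 0 then 0
  else if i ≤ n then (if j = i then 1 else 0)
  else if j + n ≤ i then -1 else 2

/-- The value of the `c`-th monomial of `B` at the point `i`. -/
def mv (n i c : ℕ) : ℂ :=
  if c = 0 then 1 else if c ≤ n then xv n i c
  else if c = n + 1 then xv n i 1 * xv n i 1 else xv n i 1 * xv n i (c - n)

lemma prod_eVec (n : ℕ) (i : Fin (2*n+1)) (j : ℕ) (h1 : 1 ≤ j) (h2 : j ≤ n) :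
    ∏ t, pts n i t ^ eVec n j t = xv n i j := by
  have hj : j - 1 < n := by omega
  rw [Finset.prod_eq_single (⟨j-1, hj⟩ : Fin n)]
  · have e1 : j - 1 + 1 = j := by omega
    have e2 : j - 1 + n + 1 = j + n := by omega
    simp only [eVec, pts, xv, e1, e2, if_true, pow_one]
  · intro b _ hb
    have : (b : ℕ) + 1 ≠ j := by
      intro h
      apply hb
      ext
      simp only
      omega
    simp [eVec, this]
  · simp

lemma prod_eVec2 (n : ℕ) (i : Fin (2*n+1)) (j k : ℕ) (h1 : 1 ≤ j) (h2 : j ≤ n)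
    (h3 : 1 ≤ k) (h4 : k ≤ n) :
    ∏ t, pts n i t ^ (eVec n j + eVec n k) t = xv n i j * xv n i k := by
  simp only [Pi.add_apply, pow_add, Finset.prod_mul_distrib]
  rw [prod_eVec n i j h1 h2, prod_eVec n i k h3 h4]

lemma prod_colB (n : ℕ) (hn : 2 ≤ n) (i : Fin (2*n+1)) (c : ℕ) (hc : c < 2*n+1) :
    ∏ t, pts n i t ^ colB n c t = mv n i c := by
  unfold mv
  split_ifs with h0 h1 h2
  · simp [colB, h0]
  · rw [← prod_eVec n i c (by omega) h1]
    simp [colB, eVec, h0, h1]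
  · rw [← prod_eVec2 n i 1 1 le_rfl (by omega) le_rfl (by omega)]
    refine Finset.prod_congr rfl fun t _ => ?_
    congr 1
    simp only [colB, eVec, Pi.add_apply]
    split_ifs <;> omega
  · rw [← prod_eVec2 n i 1 (c-n) le_rfl (by omega) (by omega) (by omega)]
    refine Finset.prod_congr rfl fun t _ => ?_
    congr 1
    simp only [colB, eVec, Pi.add_apply]
    split_ifs <;> omega

lemma ZB_apply (n : ℕ) (hn : 2 ≤ n) (i c : Fin (2*n+1)) : ZB n i c = mv n i c :=
  prod_colB n hn i c c.2

/-- Unitriangular column operations. -/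
def Uop (n : ℕ) (hn : 2 ≤ n) : Matrix (Fin (2*n+1)) (Fin (2*n+1)) ℂ :=
  Matrix.of fun d c => (if d = c then 1 else 0)
    + (if d = ⟨1, by omega⟩ then (if n + 1 ≤ (c : ℕ) then -1 else 0) else 0)
    + (if d = ⟨n+1, by omega⟩ then (if n + 2 ≤ (c : ℕ) then 1 else 0) else 0)

lemma det_Uop (n : ℕ) (hn : 2 ≤ n) : (Uop n hn).det = 1 := by
  rw [Matrix.det_of_isUpperTriangular]
  · apply Finset.prod_eq_one
    intro c _
    simp only [Uop, Matrix.of_apply, Fin.ext_iff]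
    split_ifs <;> first | omega | simp
  · intro d c hdc
    have : (c : ℕ) < d := hdc
    simp only [Uop, Matrix.of_apply, Fin.ext_iff]
    split_ifs <;> first | omega | simp

lemma mul_Uop (n : ℕ) (hn : 2 ≤ n) (i c : Fin (2*n+1)) :
    (ZB n * Uop n hn) i c = mv n i c + mv n i 1 * (if n + 1 ≤ (c : ℕ) then -1 else 0)
      + mv n i (n+1) * (if n + 2 ≤ (c : ℕ) then 1 else 0) := by
  simp only [Matrix.mul_apply, Uop, Matrix.of_apply, mul_add, Finset.sum_add_distrib, mul_ite,
    mul_zero, mul_one, Finset.sum_ite_eq', Finset.mem_univ, if_true]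
  simp only [ZB_apply n hn]

lemma mv_low (n i c : ℕ) (h0 : c ≠ 0) (h1 : c ≤ n) : mv n i c = xv n i c := by
  unfold mv
  rw [if_neg h0, if_pos h1]

lemma mv_mid (n i : ℕ) : mv n i (n+1) = xv n i 1 * xv n i 1 := by
  unfold mv
  rw [if_neg (by omega), if_neg (by omega), if_pos rfl]

lemma mv_high (n i c : ℕ) (h : n + 2 ≤ c) : mv n i c = xv n i 1 * xv n i (c - n) := by
  unfold mv
  rw [if_neg (by omega), if_neg (by omega), if_neg (by omega)]

set_option maxHeartbeats 1000000 in
lemma det_ZB (n : ℕ) (hn : 2 ≤ n) : (ZB n).det = 2 * 3^(n-1) := by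
  have h : (ZB n * Uop n hn).det = (ZB n).det := by rw [Matrix.det_mul, det_Uop, mul_one]
  rw [← h, Matrix.det_of_isLowerTriangular]
  · have e : ∀ c : Fin (2*n+1), (ZB n * Uop n hn) c c =
        (fun c : ℕ => if c ≤ n then (1:ℂ) else if c = n + 1 then 2 else 3) c := by
      intro c
      have := c.2
      rw [mul_Uop]
      simp only [mv, xv]
      split_ifs <;> first | contradiction | (exfalso; omega) | norm_num
    rw [Finset.prod_congr rfl (fun c _ => e c),
      Fin.prod_univ_eq_prod_range (fun c : ℕ => if c ≤ n then (1:ℂ) else if c = n + 1 then 2 else 3)]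
    have e2 : 2 * n + 1 = (n + 1) + 1 + (n - 1) := by omega
    rw [e2, Finset.prod_range_add, Finset.prod_range_succ, Finset.prod_eq_one, 
      Finset.prod_congr rfl (g := fun _ => (3:ℂ))]
    · simp
    · intro x _
      split_ifs <;> first | omega | rfl
    · intro x hx
      have := Finset.mem_range.1 hx
      split_ifs <;> first | omega | rfl
  · intro i c hic
    have h1 : (i : ℕ) < c := hic
    have hc := c.2
    rw [mul_Uop, mv_mid, mv_low n i 1 (by omega) (by omega)]
    by_cases c1 : (c : ℕ) ≤ n
    · rw [if_neg (by omega), if_neg (by omega), mv_low n i c (by omega) c1]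
      simp only [xv]
      split_ifs <;> first | contradiction | (exfalso; omega) | norm_num
    · by_cases c2 : (c : ℕ) = n + 1
      · rw [if_pos (by omega), if_neg (by omega), c2, mv_mid]
        simp only [xv]
        split_ifs <;> first | contradiction | (exfalso; omega) | norm_num
      · rw [if_pos (by omega), if_pos (by omega), mv_high n i c (by omega)]
        simp only [xv]
        split_ifs <;> first | contradiction | (exfalso; omega) | norm_num


/-- The matrix `Zmod` is a column rotation of a column update of `ZB`. -/
lemma det_Zmod (n : ℕ) (hn : 2 ≤ n) (p : ℕ) (hp : p < 2*n+1) (δ : Fin n → ℕ)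
    (a : Fin (2*n+1) → ℂ)
    (h : ∀ i, ∏ t, pts n i t ^ δ t = ∑ c, a c * ZB n i c) :
    (Zmod n p δ).det = (-1)^(2*n-p) * (a ⟨p, hp⟩ * (ZB n).det) := by
  have hle : (⟨p, hp⟩ : Fin (2*n+1)) ≤ Fin.last (2*n) := Fin.le_last _
  have key : Zmod n p δ = ((ZB n).updateCol ⟨p, hp⟩ (fun i => ∑ c, a c • ZB n i c)).submatrix id
      (Fin.cycleIcc ⟨p, hp⟩ (Fin.last (2*n))) := by
    ext i c
    rw [Matrix.submatrix_apply, id]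
    rcases lt_or_ge c (⟨p, hp⟩ : Fin (2*n+1)) with hc | hc
    · rw [Fin.cycleIcc_of_lt hc, Matrix.updateCol_ne hc.ne]
      have h1 : (c : ℕ) < p := hc
      have h2 : (c : ℕ) ≠ 2*n := by omega
      simp [Zmod, ZB, colMod, h1, h2]
    · have h1 : p ≤ (c : ℕ) := hc
      rcases eq_or_ne c (Fin.last (2*n)) with h2 | h2
      · subst h2
        rw [Fin.cycleIcc_of_last hle, Matrix.updateCol_self]
        simp only [smul_eq_mul]
        rw [← h i]
        simp [Zmod, colMod]
      · have h3 : c < Fin.last (2*n) := lt_of_le_of_ne (Fin.le_last _) h2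
        have h4 : (c : ℕ) < 2 * n := h3
        have h5 : ((c + 1 : Fin (2*n+1)) : ℕ) = c + 1 := Fin.val_add_one_of_lt h3
        rw [Fin.cycleIcc_of_ge_of_lt hc h3, Matrix.updateCol_ne]
        · simp only [Zmod, ZB, Matrix.of_apply, h5, colMod]
          rw [if_neg (by omega), if_neg (by omega)]
        · intro h6
          have := congrArg Fin.val h6
          rw [h5] at this
          simp only at this
          omega
  rw [key, Matrix.det_permute', Matrix.det_updateCol_sum, Fin.sign_cycleIcc_of_le hle]
  simp

/-- Coefficients expressing `x_j x_k` in `B`. -/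
def coef (n j k : ℕ) (c : ℕ) : ℂ :=
  (if c = 1 then -1 else 0) + (if c = n + 1 then 1 else 0) +
    (if j = k then (if c = j then 1 else 0)
      else (if c = n + j then -2 else 0) + (if c = n + k then 1 else 0))

lemma sum_pick (n : ℕ) (i : Fin (2*n+1)) (d : ℕ) (hd : d < 2*n+1) (s : ℂ) :
    ∑ c : Fin (2*n+1), (if (c : ℕ) = d then s else 0) * mv n i c = s * mv n i d := by
  rw [Finset.sum_eq_single (⟨d, hd⟩ : Fin (2*n+1))]
  · simp
  · intro b _ hb
    have : (b : ℕ) ≠ d := fun h => hb (Fin.ext h)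
    simp [this]
  · simp

set_option maxHeartbeats 2000000 in
lemma coef_spec (n : ℕ) (hn : 2 ≤ n) (j k : ℕ) (hj : 2 ≤ j) (hjk : j ≤ k) (hk : k ≤ n)
    (i : Fin (2*n+1)) :
    ∏ t, pts n i t ^ (eVec n j + eVec n k) t = ∑ c : Fin (2*n+1), coef n j k c * ZB n i c := by
  rw [prod_eVec2 n i j k (by omega) (by omega) (by omega) hk]
  simp only [ZB_apply n hn]
  have m1 : mv n i 1 = xv n i 1 := by
    simp only [mv]; rw [if_neg (by omega), if_pos (by omega)]
  have m2 : mv n i (n+1) = xv n i 1 * xv n i 1 := by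
    simp only [mv]; rw [if_neg (by omega), if_neg (by omega), if_pos trivial]
  have mj : mv n i j = xv n i j := by
    simp only [mv]; rw [if_neg (by omega), if_pos (by omega)]
  have mm : ∀ l, 2 ≤ l → mv n i (n+l) = xv n i 1 * xv n i l := by
    intro l hl
    simp only [mv]; rw [if_neg (by omega), if_neg (by omega), if_neg (by omega), Nat.add_sub_cancel_left]
  have hi := i.2
  by_cases e : j = k
  · simp only [coef, if_pos e, add_mul, Finset.sum_add_distrib]
    rw [sum_pick n i 1 (by omega), sum_pick n i (n+1) (by omega), sum_pick n i j (by omega),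
      m1, m2, mj, ← e]
    simp only [xv]
    split_ifs <;> first | contradiction | (exfalso; omega) | norm_num
  · simp only [coef, if_neg e, add_mul, Finset.sum_add_distrib]
    rw [sum_pick n i 1 (by omega), sum_pick n i (n+1) (by omega), sum_pick n i (n+j) (by omega),
      sum_pick n i (n+k) (by omega), m1, m2, mm j hj, mm k (by omega)]
    simp only [xv]
    split_ifs <;> first | contradiction | (exfalso; omega) | norm_num

lemma sign_congr {a b : ℕ} (h : a % 2 = b % 2) : (-1 : ℂ)^a = (-1)^b := by
  rw [neg_one_pow_eq_pow_mod_two, h, ← neg_one_pow_eq_pow_mod_two]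

lemma det_Zmod' (n : ℕ) (hn : 2 ≤ n) (p : ℕ) (hp : p < 2*n+1) (j k : ℕ) (hj : 2 ≤ j)
    (hjk : j ≤ k) (hk : k ≤ n) :
    (Zmod n p (eVec n j + eVec n k)).det = (-1)^(2*n-p) * (coef n j k p * (ZB n).det) :=
  det_Zmod n hn p hp _ (fun c => coef n j k c) (coef_spec n hn j k hj hjk hk)

/-- Explicit evaluation of the maximal minors `m = det Z_B` and
`m_γ^δ = det Z_{(B∖{γ})∪{δ}}` at the specialized points, used to prove that
`(n, 2n+1)` is a very efficient format.  Here `2e₁` sits at position `n+1` of `B` and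
`e₁+e_i` at position `n+i`. -/
theorem statement14 (n : ℕ) (hn : 2 ≤ n) :
    (ZB n).det = 2 * 3^(n-1) ∧
    (∀ j k : ℕ, 2 ≤ j → j ≤ k → k ≤ n →
      (Zmod n (n+1) (eVec n j + eVec n k)).det = (-1)^(n+1) * (ZB n).det) ∧
    (∀ j k : ℕ, 2 ≤ j → j < k → k ≤ n →
      (Zmod n (n+j) (eVec n j + eVec n k)).det = (-1)^(n+j+1) * (2 * (ZB n).det)) ∧
    (∀ j k : ℕ, 2 ≤ j → j < k → k ≤ n →
      (Zmod n (n+k) (eVec n j + eVec n k)).det = (-1)^(n+k) * (ZB n).det) ∧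
    (∀ i j k : ℕ, 2 ≤ i → i ≤ n → 2 ≤ j → j ≤ k → k ≤ n →
      (j = k ∨ (j < k ∧ i ≠ j ∧ i ≠ k)) →
      (Zmod n (n+i) (eVec n j + eVec n k)).det = 0) := by
  refine ⟨det_ZB n hn, ?_, ?_, ?_, ?_⟩
  · intro j k hj hjk hk
    rw [det_Zmod' n hn _ (by omega) j k hj hjk hk]
    have : coef n j k (n+1) = 1 := by
      unfold coef
      split_ifs <;> first | (exfalso; omega) | norm_num
    rw [this, one_mul, sign_congr (b := n+1) (by omega)]
  · intro j k hj hjk hk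
    rw [det_Zmod' n hn _ (by omega) j k hj hjk.le hk]
    have : coef n j k (n+j) = -2 := by
      unfold coef
      split_ifs <;> first | (exfalso; omega) | norm_num
    rw [this, sign_congr (b := n+j) (by omega)]
    ring
  · intro j k hj hjk hk
    rw [det_Zmod' n hn _ (by omega) j k hj hjk.le hk]
    have : coef n j k (n+k) = 1 := by
      unfold coef
      split_ifs <;> first | (exfalso; omega) | norm_num
    rw [this, one_mul, sign_congr (b := n+k) (by omega)]
  · intro i j k hi hin hj hjk hk hh
    rw [det_Zmod' n hn _ (by omega) j k hj hjk hk]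
    have : coef n j k (n+i) = 0 := by
      unfold coef
      split_ifs <;> first | (exfalso; omega) | norm_num
    rw [this, zero_mul, mul_zero]


end
end

section
/- For integers n ≥ 1 and 1 ≤ c ≤ n define E1count(n,c) := C(n−c+1,2)·( C(c+2,3) + (n−c)·C(c+1,2) ) and Ycount(n,c) := C(c+4,5) + (n−c)·C(c+3,4) + C(n−c+1,2)·C(c+2,3) + C(n−c+2,3)·C(c+1,2). Let t* be the unique real root of the cubic 16t³ − 55t² + 60t − 20 (one has 0.632 < t* < 1). Then for every real t with 0 < t < t* there exists N ∈ ℕ such that for all n ≥ N, E1count(n, ⌊t·n⌋) ≥ Ycount(n, ⌊t·n⌋). -/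
open scoped BigOperators

/-- `|E₁|`, the number of linear determinantal relations, for rank
`r = Σ_{j=0}^c (n−j+1)`. -/
def E1count (n c : ℕ) : ℕ :=
  Nat.choose (n-c+1) 2 * (Nat.choose (c+2) 3 + (n-c) * Nat.choose (c+1) 2)

/-- `|Y|`, the number of moment variables, for rank `r = Σ_{j=0}^c (n−j+1)`. -/
def Ycount (n c : ℕ) : ℕ :=
  Nat.choose (c+4) 5 + (n-c) * Nat.choose (c+3) 4
    + Nat.choose (n-c+1) 2 * Nat.choose (c+2) 3
    + Nat.choose (n-c+2) 3 * Nat.choose (c+1) 2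

lemma ch2 (m : ℕ) : ((Nat.choose (m+1) 2 : ℕ) : ℝ) = (m:ℝ)*(m+1)/2 := by
  induction m with
  | zero => simp
  | succ k ih =>
    rw [Nat.choose_succ_succ' (k+1) 1, Nat.choose_one_right]
    push_cast
    rw [ih]; ring

lemma ch3 (m : ℕ) : ((Nat.choose (m+2) 3 : ℕ) : ℝ) = (m:ℝ)*(m+1)*(m+2)/6 := by
  induction m with
  | zero => simp
  | succ k ih =>
    rw [show k+1+2 = (k+2)+1 by ring, Nat.choose_succ_succ' (k+2) 2, Nat.cast_add, ih,
      show k+2 = (k+1)+1 by ring, ch2]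
    push_cast
    ring

lemma ch4 (m : ℕ) : ((Nat.choose (m+3) 4 : ℕ) : ℝ) = (m:ℝ)*(m+1)*(m+2)*(m+3)/24 := by
  induction m with
  | zero => simp
  | succ k ih =>
    rw [show k+1+3 = (k+3)+1 by ring, Nat.choose_succ_succ' (k+3) 3, Nat.cast_add, ih,
      show k+3 = (k+1)+2 by ring, ch3]
    push_cast
    ring

lemma ch5 (m : ℕ) : ((Nat.choose (m+4) 5 : ℕ) : ℝ) = (m:ℝ)*(m+1)*(m+2)*(m+3)*(m+4)/120 := by
  induction m with
  | zero => simp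
  | succ k ih =>
    rw [show k+1+4 = (k+4)+1 by ring, Nat.choose_succ_succ' (k+4) 4, Nat.cast_add, ih,
      show k+4 = (k+1)+3 by ring, ch4]
    push_cast
    ring

lemma diff_eq (n c : ℕ) (d : ℝ) (hc : c ≤ n) (hd : d = (n:ℝ) - c) :
    (E1count n c : ℝ) - Ycount n c = (c:ℝ)*(c+1)/120 *
      (20*d^3 - c^3 - 5*d*c^2 - 9*c^2 - 25*c*d - 26*c - 50*d - 24) := by
  have h : ((n - c : ℕ) : ℝ) = d := by rw [Nat.cast_sub hc, hd]
  unfold E1count Ycount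
  push_cast
  rw [ch2, ch2, ch3, ch3, ch4, ch5, h]
  ring

/-- Let `t*` be the unique real root of `16t³ − 55t² + 60t − 20` (it satisfies
`0.632 < t* < 1`).  For every `0 < t < t*` the number of linear relations eventually
dominates the number of moment variables along `c = ⌊t·n⌋`. -/
theorem statement15 (tstar : ℝ)
    (hroot : 16*tstar^3 - 55*tstar^2 + 60*tstar - 20 = 0)
    (huniq : ∀ s : ℝ, 16*s^3 - 55*s^2 + 60*s - 20 = 0 → s = tstar) :
    (0.632 < tstar ∧ tstar < 1) ∧
    ∀ t : ℝ, 0 < t → t < tstar →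
      ∃ N : ℕ, ∀ n : ℕ, N ≤ n →
        Ycount n ⌊t * n⌋₊ ≤ E1count n ⌊t * n⌋₊ := by
  have hcont : Continuous (fun s : ℝ => 16*s^3 - 55*s^2 + 60*s - 20) := by fun_prop
  have hb : 0.632 < tstar ∧ tstar < 1 := by
    obtain ⟨s, hs, hs0⟩ := intermediate_value_Ioo (a := (0.632:ℝ)) (b := 1) (by norm_num)
      hcont.continuousOn (show (0:ℝ) ∈ _ by constructor <;> norm_num)
    rw [← huniq s hs0]
    exact hs
  refine ⟨hb, fun t ht0 htt => ?_⟩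
  have hneg : ∀ x : ℝ, 0 ≤ x → x ≤ t → 16*x^3 - 55*x^2 + 60*x - 20 < 0 := by
    intro x hx0 hxt
    by_contra hcon
    obtain ⟨s, hs, hs0⟩ := intermediate_value_Icc hx0
      hcont.continuousOn (show (0:ℝ) ∈ _ from ⟨by norm_num, not_lt.mp hcon⟩)
    have := huniq s hs0
    linarith [hs.2]
  obtain ⟨x0, hx0, hmax⟩ := (isCompact_Icc (a := (0:ℝ)) (b := t)).exists_isMaxOn
    ⟨0, le_refl _, ht0.le⟩ hcont.continuousOn
  obtain ⟨δ, hδ⟩ : ∃ δ : ℝ, δ = -(16*x0^3 - 55*x0^2 + 60*x0 - 20) := ⟨_, rfl⟩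
  have hδ0 : 0 < δ := by have := hneg x0 hx0.1 hx0.2; linarith
  have hq : ∀ x : ℝ, 0 ≤ x → x ≤ t → δ ≤ -(16*x^3 - 55*x^2 + 60*x - 20) := by
    intro x h0 h1
    have : (16*x^3 - 55*x^2 + 60*x - 20) ≤ (16*x0^3 - 55*x0^2 + 60*x0 - 20) := hmax ⟨h0, h1⟩
    linarith
  obtain ⟨N, hN⟩ := exists_nat_ge (134/δ)
  refine ⟨N + 1, fun n hn => ?_⟩
  have hn1 : (1:ℝ) ≤ n := by exact_mod_cast (by omega : 1 ≤ n)
  have hnpos : (0:ℝ) < n := by linarith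
  have hnN : 134 ≤ δ * n := by
    have h1 : (N:ℝ) ≤ n := by exact_mod_cast (by omega : N ≤ n)
    have h2 : 134/δ ≤ n := hN.trans h1
    rw [div_le_iff₀ hδ0] at h2
    linarith
  have hfl : ((⌊t * n⌋₊ : ℕ) : ℝ) ≤ t * n := Nat.floor_le (by positivity)
  generalize ⌊t * (n:ℝ)⌋₊ = c at hfl ⊢
  have hcn' : (c:ℝ) ≤ n := by nlinarith [hb.2]
  have hcn : c ≤ n := by exact_mod_cast hcn'
  have hc0 : (0:ℝ) ≤ c := Nat.cast_nonneg c
  have hdiff := diff_eq n c _ hcn rfl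
  have hx := hq (c/n) (by positivity) (by rw [div_le_iff₀ hnpos]; exact hfl)
  have hmain : δ * (n:ℝ)^3 ≤ 20*((n:ℝ)-c)^3 - c^3 - 5*((n:ℝ)-c)*c^2 := by
    have := mul_le_mul_of_nonneg_right hx (by positivity : (0:ℝ) ≤ (n:ℝ)^3)
    refine this.trans (le_of_eq ?_)
    field_simp
    ring
  have h3 : 134 * (n:ℝ)^2 ≤ δ * (n:ℝ)^3 := by
    have := mul_le_mul_of_nonneg_right hnN (by positivity : (0:ℝ) ≤ (n:ℝ)^2)
    linarith [this]
  have hcc : (c:ℝ)^2 ≤ n^2 := by gcongr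
  have hcd : (c:ℝ)*((n:ℝ)-c) ≤ n^2 := by nlinarith
  have hnn : (n:ℝ) ≤ n^2 := by nlinarith
  have hbr : 0 ≤ 20*((n:ℝ)-c)^3 - c^3 - 5*((n:ℝ)-c)*c^2 - 9*c^2 - 25*c*((n:ℝ)-c) - 26*c
      - 50*((n:ℝ)-c) - 24 := by
    nlinarith
  have : (0:ℝ) ≤ (E1count n c : ℝ) - Ycount n c := by
    rw [hdiff]
    exact mul_nonneg (by positivity) hbr
  exact_mod_cast sub_nonneg.mp this
end

section
/- Let n ≥ 1, let z_1, …, z_{n+1} ∈ ℂ^{n+1} be vectors each having 0-th coordinate equal to 1, let t ∈ ℂ, and set z_{n+2} := t·z_1 + (1−t)·z_2. For 1 ≤ i ≤ j ≤ n let M(i,j) be the (n+2) × (n+2) matrix whose rows are indexed by k ∈ {1,…,n+2} and whose columns are: the all-ones column (z_{k,0})_k, the columns (z_{k,1})_k, …, (z_{k,n})_k, and finally the column (z_{k,i}·z_{k,j})_k; extend the notation to all i, j by M(i,j) := M(min(i,j), max(i,j)). Then for all i, j, k, ℓ ∈ {1,…,n}: det(M(i,j))·det(M(k,ℓ)) −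 det(M(i,k))·det(M(j,ℓ)) = 0. -/
open scoped BigOperators

noncomputable section

/-- The `n+2` points: `z 0, …, z n` together with the collinear point
`t·z 0 + (1−t)·z 1`. -/
def wpts (n : ℕ) (z : Fin (n+1) → Fin (n+1) → ℂ) (t : ℂ) :
    Fin (n+2) → Fin (n+1) → ℂ :=
  Fin.snoc z (fun a => t * z 0 a + (1 - t) * z 1 a)

/-- The matrix `M(i,j) = Z_{B∖{x₁²}∪{x_i x_j}}` of the `n+2` points with respect to the
monomial set `{1, x₁, …, x_n, x_i x_j}` (here `i, j : Fin n` index the coordinates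
`1,…,n` via `Fin.succ`). -/
def Mcol (n : ℕ) (z : Fin (n+1) → Fin (n+1) → ℂ) (t : ℂ) (i j : Fin n) :
    Matrix (Fin (n+2)) (Fin (n+2)) ℂ :=
  Matrix.of fun r c =>
    if h : (c : ℕ) < n + 1 then wpts n z t r ⟨c, h⟩
    else wpts n z t r i.succ * wpts n z t r j.succ

/-- Subtracting the first two rows from the last one, the determinant factors. -/
lemma det_Mcol_eq (n : ℕ) (hn : 1 ≤ n) (z : Fin (n+1) → Fin (n+1) → ℂ) (t : ℂ) (i j : Fin n) :
    (Mcol n z t i j).det = (-(t * (1 - t)) * (Matrix.of z).det) *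
      ((z 0 i.succ - z 1 i.succ) * (z 0 j.succ - z 1 j.succ)) := by
  set M := Mcol n z t i j with hM
  have hcc : ∀ r c : Fin (n+1), M r.castSucc c.castSucc = z r c := by
    intro r c
    simp [hM, Mcol, wpts]
    intro h
    exact absurd c.isLt (by omega)
  have hcl : ∀ r : Fin (n+1), M r.castSucc (Fin.last _) = z r i.succ * z r j.succ := by
    intro r
    simp [hM, Mcol, wpts]
  have hlc : ∀ c : Fin (n+1), M (Fin.last _) c.castSucc = t * z 0 c + (1 - t) * z 1 c := by
    intro c
    simp [hM, Mcol, wpts]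
    intro h
    exact absurd c.isLt (by omega)
  have hll : M (Fin.last _) (Fin.last _) = (t * z 0 i.succ + (1 - t) * z 1 i.succ) *
      (t * z 0 j.succ + (1 - t) * z 1 j.succ) := by
    simp [hM, Mcol, wpts]
  clear_value M
  have h0 : Fin.last (n+1) ≠ (0 : Fin (n+1)).castSucc := (Fin.castSucc_lt_last _).ne'
  have h1 : Fin.last (n+1) ≠ (1 : Fin (n+1)).castSucc := (Fin.castSucc_lt_last _).ne'
  have e1 := Matrix.det_updateRow_add_smul_self M h0 (-t)
  set M' := M.updateRow (Fin.last (n+1)) (M (Fin.last _) + (-t) • M (0 : Fin (n+1)).castSucc)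
    with hM'
  have e2 := Matrix.det_updateRow_add_smul_self M' h1 (-(1 - t))
  set N := M'.updateRow (Fin.last (n+1))
    (M' (Fin.last _) + (-(1 - t)) • M' (1 : Fin (n+1)).castSucc) with hN
  have hNl : ∀ c, N (Fin.last _) c = M (Fin.last _) c - t * M (0 : Fin (n+1)).castSucc c
      - (1 - t) * M (1 : Fin (n+1)).castSucc c := by
    intro c
    rw [hN, Matrix.updateRow_self, Pi.add_apply, Pi.smul_apply, hM', Matrix.updateRow_self,
      Matrix.updateRow_ne h1.symm]
    simp only [Pi.add_apply, Pi.smul_apply, smul_eq_mul]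
    ring
  have hNc : ∀ r : Fin (n+1), N r.castSucc = M r.castSucc := by
    intro r
    rw [hN, Matrix.updateRow_ne (Fin.castSucc_lt_last _).ne, hM',
      Matrix.updateRow_ne (Fin.castSucc_lt_last _).ne]
  clear_value N M'
  rw [← e1, ← e2, Matrix.det_succ_row N (Fin.last _), Fin.sum_univ_castSucc,
    Finset.sum_eq_zero]
  · have hs : N.submatrix (Fin.last (n+1)).succAbove (Fin.last (n+1)).succAbove
        = Matrix.of z := by
      ext r c
      simp [Fin.succAbove_last, hNc, hcc]
    rw [hs, hNl, hll, hcl, hcl]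
    have : ((-1 : ℂ)) ^ ((Fin.last (n+1) : ℕ) + (Fin.last (n+1) : ℕ)) = 1 :=
      Even.neg_one_pow ⟨_, rfl⟩
    rw [this]
    ring
  · intro c _
    rw [hNl, hlc, hcc, hcc]
    ring

/-- When the last point is collinear with the first two, the maximal minors satisfy the
quadratic relations `det M(i,j)·det M(k,ℓ) = det M(i,k)·det M(j,ℓ)`. -/
theorem statement16 (n : ℕ) (hn : 1 ≤ n) (z : Fin (n+1) → Fin (n+1) → ℂ)
    (hz : ∀ k, z k 0 = 1) (t : ℂ) (i j k l : Fin n) :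
    (Mcol n z t i j).det * (Mcol n z t k l).det
      = (Mcol n z t i k).det * (Mcol n z t j l).det := by
  simp only [det_Mcol_eq n hn]
  ring

end
end

section
/- Let n ≥ 1 and let d_0, d_1, …, d_n ∈ ℕ satisfy 1 ≤ d_0 ≤ d_1 ≤ … ≤ d_n; set d := Σ_{j=0}^n d_j and D := (d_0, …, d_n) ∈ ℕ^{n+1}. Suppose s ∈ ℕ, λ_1, …, λ_s ∈ ℂ, and z_1, …, z_s ∈ ℂ^{n+1} satisfy Σ_{i=1}^s λ_i·z_i^γ = 1 if γ = D and = 0 otherwise, for every γ ∈ ℕ^{n+1} with |γ| = d. Then s ≥ ∏_{j=1}^n (d_j + 1). In other words, the Waring rank of the monomial x_0^{d_0} x_1^{d_1} ⋯ x_n^{d_n} (viewed as a symmetric tensor whose only nonzero entry is the one indexed by D) is at least ∏_{j=1}^n (d_j + 1). -/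
open scoped BigOperators

/-- Lower bound on the Waring rank of a monomial: any decomposition
`x_0^{d_0}⋯x_n^{d_n} = Σ_i λ_i z_i^{⊗d}` with `1 ≤ d_0 ≤ d_1 ≤ … ≤ d_n` has size
at least `∏_{j=1}^n (d_j + 1)`. -/
theorem statement17 (n : ℕ) (hn : 1 ≤ n) (d : Fin (n+1) → ℕ)
    (hd0 : 1 ≤ d 0) (hmono : Monotone d) (s : ℕ)
    (lam : Fin s → ℂ) (z : Fin s → Fin (n+1) → ℂ)
    (hdec : ∀ γ : Fin (n+1) → ℕ, (∑ j, γ j = ∑ j, d j) →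
      (∑ i, lam i * ∏ j, z i j ^ γ j) = if γ = d then 1 else 0) :
    ∏ j : Fin n, (d j.succ + 1) ≤ s := by
  classical
  let A := (j : Fin n) → Fin (d j.succ + 1)
  let v : A → Fin s → ℂ := fun a i => ∏ j : Fin n, (z i j.succ / z i 0) ^ (a j : ℕ)
  have hli : LinearIndependent ℂ v := by
    rw [Fintype.linearIndependent_iff]
    intro c hc
    by_contra hne
    push Not at hne
    let S : Finset A := Finset.univ.filter (fun a => c a ≠ 0)
    have hS : S.Nonempty := by
      obtain ⟨a, ha⟩ := hne
      exact ⟨a, by simp [S, ha]⟩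
    obtain ⟨a, haS, hmax⟩ := S.exists_max_image (fun a => ∑ j, (a j : ℕ)) hS
    have hca : c a ≠ 0 := by simpa [S] using haS
    set e : ℕ := ∑ j, (a j : ℕ) with he
    let g : A → Fin (n+1) → ℕ := fun b =>
      Fin.cons (d 0 + (e - ∑ j, (b j : ℕ))) (fun j => (d j.succ - (a j : ℕ)) + (b j : ℕ))
    have hale : ∀ j, (a j : ℕ) ≤ d j.succ := fun j => Nat.lt_succ_iff.mp (a j).2
    have key : ∀ b : A, (∑ j, (b j : ℕ)) ≤ e → ∀ i,
        z i 0 ^ (d 0 + e) * (∏ j : Fin n, z i j.succ ^ (d j.succ - (a j : ℕ))) * v b i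
          = ∏ j, z i j ^ g b j := by
      intro b hb i
      rw [Fin.prod_univ_succ]
      simp only [g, Fin.cons_zero, Fin.cons_succ, v, div_pow, pow_add, Finset.prod_mul_distrib,
        Finset.prod_div_distrib, Finset.prod_pow_eq_pow_sum]
      by_cases h0 : z i 0 = 0
      · have : d 0 ≠ 0 := by omega
        simp [h0, this]
      · have h1 : z i 0 ^ e = z i 0 ^ (e - ∑ j, (b j : ℕ)) * z i 0 ^ (∑ j, (b j : ℕ)) := by
          rw [← pow_add, Nat.sub_add_cancel hb]
        rw [h1]
        field_simp
    have hdeg : ∀ b : A, (∑ j, (b j : ℕ)) ≤ e → ∑ j, g b j = ∑ j, d j := by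
      intro b hb
      rw [Fin.sum_univ_succ, Fin.sum_univ_succ d]
      simp only [g, Fin.cons_zero, Fin.cons_succ, Finset.sum_add_distrib]
      have h2 : ∑ j : Fin n, (d j.succ - (a j : ℕ)) + e = ∑ j : Fin n, d j.succ := by
        rw [he, ← Finset.sum_add_distrib]
        exact Finset.sum_congr rfl fun j _ => Nat.sub_add_cancel (hale j)
      omega
    have hgd : ∀ b : A, g b = d ↔ b = a := by
      intro b
      constructor
      · intro h
        funext j
        have := congrFun h j.succ
        simp only [g, Fin.cons_succ] at this
        have := hale j
        apply Fin.ext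
        omega
      · rintro rfl
        funext j
        refine Fin.cases ?_ (fun j => ?_) j
        · simp [g, he]
        · simp only [g, Fin.cons_succ]
          exact Nat.sub_add_cancel (hale j)
    have hsum : ∑ b, c b * ∑ i, lam i * (z i 0 ^ (d 0 + e) *
        (∏ j : Fin n, z i j.succ ^ (d j.succ - (a j : ℕ))) * v b i) = 0 := by
      simp only [Finset.mul_sum]
      rw [Finset.sum_comm]
      refine Finset.sum_eq_zero fun i _ => ?_
      have hi : ∑ b, c b * v b i = 0 := by
        have := congrFun hc i
        simpa using this
      rw [← mul_zero (lam i * (z i 0 ^ (d 0 + e) *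
        (∏ j : Fin n, z i j.succ ^ (d j.succ - (a j : ℕ))))), ← hi, Finset.mul_sum]
      refine Finset.sum_congr rfl fun b _ => ?_
      ring
    have hsum2 : ∑ b, c b * ∑ i, lam i * (z i 0 ^ (d 0 + e) *
        (∏ j : Fin n, z i j.succ ^ (d j.succ - (a j : ℕ))) * v b i)
        = ∑ b, if b = a then c b else 0 := by
      refine Finset.sum_congr rfl fun b _ => ?_
      by_cases hcb : c b = 0
      · simp [hcb]
      · have hb := hmax b (by simp [S, hcb])
        simp only [key b hb]
        rw [hdec _ (hdeg b hb)]
        simp [hgd]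
    rw [hsum2] at hsum
    rw [Finset.sum_eq_single a (fun b _ hb => if_neg hb)
      (fun h => absurd (Finset.mem_univ a) h), if_pos rfl] at hsum
    exact hca hsum
  have := hli.fintype_card_le_finrank
  simpa [A] using this
end

section
/- Let n ≥ 1 and let d_0, d_1, …, d_n ∈ ℕ satisfy 1 ≤ d_0 ≤ d_1 ≤ … ≤ d_n; set d := Σ_{j=0}^n d_j and D := (d_0, …, d_n) ∈ ℕ^{n+1}. Then the least s ∈ ℕ for which there exist λ_1, …, λ_s ∈ ℂ and z_1, …, z_s ∈ ℂ^{n+1} with Σ_{i=1}^s λ_i·z_i^γ = 1 if γ = D and = 0 otherwise, for every γ ∈ ℕ^{n+1} with |γ| = d, equals ∏_{j=1}^n (d_j + 1). That is, the Waring rank over ℂ of the monomial x_0^{d_0} x_1^{d_1} ⋯ x_n^{d_n} is exactly ∏_{j=1}^n (d_j + 1); in particular a decomposition of this size exists (it can be realized with points whose coordinates are roots of unity, the point indexed by a tuple (ζ_1,…,ζ_n) of (d_j+1)-st roots of unity being (1, ζ_1, …, ζ_n)). -/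
open scoped BigOperators

lemma roots_sum (m k : ℕ) (ζ : ℂ) (hζ : IsPrimitiveRoot ζ (m+1)) :
    (∑ a : Fin (m+1), (ζ ^ (a:ℕ)) ^ k) = if (m+1) ∣ k then ((m:ℂ)+1) else 0 := by
  have h1 : (∑ a : Fin (m+1), (ζ ^ (a:ℕ)) ^ k) = ∑ a ∈ Finset.range (m+1), (ζ^k)^a := by
    rw [← Fin.sum_univ_eq_sum_range (fun a => (ζ^k)^a)]
    refine Finset.sum_congr rfl fun a _ => ?_
    rw [← pow_mul, ← pow_mul, mul_comm]
  rw [h1]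
  split_ifs with h
  · rw [(hζ.pow_eq_one_iff_dvd k).2 h]
    simp
  · have h2 : ζ^k ≠ 1 := fun h' => h ((hζ.pow_eq_one_iff_dvd k).1 h')
    have h3 := geom_sum_mul (ζ^k) (m+1)
    rw [← pow_mul, mul_comm k, pow_mul, hζ.pow_eq_one, one_pow, sub_self] at h3
    exact (mul_eq_zero.1 h3).resolve_right (sub_ne_zero.2 h2)

lemma upper (n : ℕ) (d : Fin (n+1) → ℕ) (hmono : Monotone d) :
    ∃ (lam : Fin (∏ j : Fin n, (d j.succ + 1)) → ℂ)
      (z : Fin (∏ j : Fin n, (d j.succ + 1)) → Fin (n+1) → ℂ),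
        ∀ γ : Fin (n+1) → ℕ, (∑ j, γ j = ∑ j, d j) →
          (∑ i, lam i * ∏ j, z i j ^ γ j) = if γ = d then 1 else 0 := by
  have hcard : Fintype.card ((j : Fin n) → Fin (d j.succ + 1)) = ∏ j : Fin n, (d j.succ + 1) := by
    simp
  let e : ((j : Fin n) → Fin (d j.succ + 1)) ≃ Fin (∏ j : Fin n, (d j.succ + 1)) :=
    Fintype.equivFinOfCardEq hcard
  let ζ : Fin n → ℂ := fun j => Complex.exp (2 * Real.pi * Complex.I / ((d j.succ + 1 : ℕ) : ℂ))
  have hζ : ∀ j, IsPrimitiveRoot (ζ j) (d j.succ + 1) := fun j =>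
    Complex.isPrimitiveRoot_exp _ (Nat.succ_ne_zero _)
  refine ⟨fun i => ∏ j, ((ζ j ^ ((e.symm i j : ℕ))) / ((d j.succ : ℂ) + 1)),
    fun i => Fin.cons 1 (fun j => ζ j ^ ((e.symm i j : ℕ))), fun γ hγ => ?_⟩
  rw [← e.sum_comp]
  have h1 : ∀ a : ((j : Fin n) → Fin (d j.succ + 1)),
      (∏ j, ((ζ j ^ ((e.symm (e a) j : ℕ))) / ((d j.succ : ℂ) + 1))) *
        ∏ j, (Fin.cons 1 (fun j => ζ j ^ ((e.symm (e a) j : ℕ))) : Fin (n+1) → ℂ) j ^ γ j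
      = ∏ j, ((ζ j ^ (a j : ℕ)) ^ (γ j.succ + 1) / ((d j.succ : ℂ) + 1)) := by
    intro a
    rw [Fin.prod_univ_succ]
    simp only [Equiv.symm_apply_apply, Fin.cons_zero, Fin.cons_succ, one_pow, one_mul]
    rw [← Finset.prod_mul_distrib]
    refine Finset.prod_congr rfl fun j _ => ?_
    ring
  simp only [h1]
  rw [← Fintype.prod_sum (fun j (b : Fin (d j.succ + 1)) =>
    ((ζ j ^ (b : ℕ)) ^ (γ j.succ + 1) / ((d j.succ : ℂ) + 1)))]
  have h2 : ∀ j, (∑ b : Fin (d j.succ + 1), ((ζ j ^ (b : ℕ)) ^ (γ j.succ + 1) / ((d j.succ : ℂ) + 1)))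
      = if (d j.succ + 1) ∣ (γ j.succ + 1) then 1 else 0 := by
    intro j
    rw [← Finset.sum_div, roots_sum _ _ _ (hζ j)]
    split_ifs
    · exact div_self (Nat.cast_add_one_ne_zero _)
    · simp
  simp only [h2]
  split_ifs with h
  · subst h; simp
  · by_contra hne
    rw [Finset.prod_eq_zero_iff] at hne
    push Not at hne
    have hdv : ∀ j : Fin n, (d j.succ + 1) ∣ (γ j.succ + 1) := fun j => by
      by_contra h'
      exact hne j (Finset.mem_univ _) (if_neg h')
    have hle : ∀ j : Fin n, d j.succ ≤ γ j.succ := fun j => by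
      have := Nat.le_of_dvd (Nat.succ_pos _) (hdv j)
      omega
    rw [Fin.sum_univ_succ, Fin.sum_univ_succ] at hγ
    have heq : ∀ j : Fin n, γ j.succ = d j.succ := by
      intro j
      by_contra hj
      have h3 : d j.succ + d 0 + 1 ≤ γ j.succ := by
        have h0 : d 0 ≤ d j.succ := hmono (Fin.zero_le _)
        obtain ⟨c, hc⟩ := hdv j
        have hc2 : 2 ≤ c := by
          by_contra hlt
          have : c = 0 ∨ c = 1 := by omega
          rcases this with rfl | rfl <;> omega
        have := Nat.mul_le_mul_left (d j.succ + 1) hc2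
        omega
      have h4 := Finset.add_sum_erase Finset.univ (fun j : Fin n => γ j.succ) (Finset.mem_univ j)
      have h5 := Finset.add_sum_erase Finset.univ (fun j : Fin n => d j.succ) (Finset.mem_univ j)
      have h6 : ∑ x ∈ Finset.univ.erase j, d (Fin.succ x) ≤ ∑ x ∈ Finset.univ.erase j, γ (Fin.succ x) :=
        Finset.sum_le_sum fun x _ => hle x
      omega
    apply h
    funext j
    refine Fin.cases ?_ heq j
    simp only [heq] at hγ
    omega

lemma lower (n : ℕ) (d : Fin (n+1) → ℕ) (hd0 : 1 ≤ d 0) (s : ℕ)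
    (lam : Fin s → ℂ) (z : Fin s → Fin (n+1) → ℂ)
    (h : ∀ γ : Fin (n+1) → ℕ, (∑ j, γ j = ∑ j, d j) →
          (∑ i, lam i * ∏ j, z i j ^ γ j) = if γ = d then 1 else 0) :
    ∏ j : Fin n, (d j.succ + 1) ≤ s := by
  by_contra hlt
  let v : ((j : Fin n) → Fin (d j.succ + 1)) → Fin s → ℂ :=
    fun b i => ∏ j, (z i j.succ / z i 0) ^ (b j : ℕ)
  have hdep : ¬ LinearIndependent ℂ v := by
    intro hv
    have := hv.fintype_card_le_finrank
    simp at this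
    omega
  rw [Fintype.not_linearIndependent_iff] at hdep
  obtain ⟨c, hc, b0, hb0⟩ := hdep
  let S : ((j : Fin n) → Fin (d j.succ + 1)) → ℕ := fun b => ∑ j, (b j : ℕ)
  obtain ⟨b, hb, hmax⟩ := Finset.exists_max_image
    (Finset.univ.filter fun b => c b ≠ 0) S ⟨b0, by simp [hb0]⟩
  replace hb : c b ≠ 0 := by simpa using hb
  replace hmax : ∀ b', c b' ≠ 0 → S b' ≤ S b := fun b' hb' => hmax b' (by simpa using hb')
  let g : ((j : Fin n) → Fin (d j.succ + 1)) → Fin (n+1) → ℕ := fun b' =>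
    Fin.cons (d 0 + (S b - S b')) (fun j => d j.succ - (b j : ℕ) + (b' j : ℕ))
  have hzero : ∑ b', c b' * ∑ i, lam i * ∏ j, z i j ^ g b' j = 0 := by
    simp only [Finset.mul_sum]
    rw [Finset.sum_comm]
    refine Finset.sum_eq_zero fun i _ => ?_
    by_cases hz : z i 0 = 0
    · refine Finset.sum_eq_zero fun b' _ => ?_
      rw [Fin.prod_univ_succ, hz]
      simp only [g, Fin.cons_zero]
      rw [zero_pow (by omega)]
      simp
    · have hci := congrFun hc i
      simp only [Finset.sum_apply, Pi.smul_apply, smul_eq_mul, Pi.zero_apply] at hci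
      calc _ = ∑ b', (lam i * z i 0 ^ (d 0 + S b) * ∏ j : Fin n, z i j.succ ^ (d j.succ - (b j : ℕ)))
                * (c b' * v b' i) := by
            refine Finset.sum_congr rfl fun b' _ => ?_
            by_cases hb' : c b' = 0
            · simp [hb']
            have hS := hmax b' hb'
            have hv : v b' i = (∏ j : Fin n, z i j.succ ^ (b' j : ℕ)) / z i 0 ^ S b' := by
              simp only [v, S, div_pow, Finset.prod_div_distrib, Finset.prod_pow_eq_pow_sum]
            have hp : z i 0 ^ (d 0 + S b) = z i 0 ^ (d 0 + (S b - S b')) * z i 0 ^ S b' := by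
              rw [← pow_add]; congr 1; omega
            rw [hv, hp, Fin.prod_univ_succ]
            simp only [g, Fin.cons_zero, Fin.cons_succ, pow_add, Finset.prod_mul_distrib]
            field_simp
        _ = 0 := by rw [← Finset.mul_sum, hci, mul_zero]
  have hval : ∀ b', c b' * ∑ i, lam i * ∏ j, z i j ^ g b' j = if b' = b then c b else 0 := by
    intro b'
    by_cases hb' : c b' = 0
    · rw [hb', zero_mul, if_neg]
      rintro rfl
      exact hb hb'
    have hS := hmax b' hb'
    have hbl : ∀ j, (b j : ℕ) ≤ d j.succ := fun j => Nat.lt_succ_iff.1 (b j).2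
    rw [h]
    · by_cases hbb : b' = b
      · subst hbb
        have : g b' = d := by
          funext j
          refine Fin.cases ?_ (fun j => ?_) j
          · simp [g]
          · have := hbl j
            simp only [g, Fin.cons_succ]; omega
        simp [this]
      · rw [if_neg hbb, if_neg, mul_zero]
        intro hg
        apply hbb
        funext j
        have h1 := congrFun hg j.succ
        simp only [g, Fin.cons_succ] at h1
        have := hbl j
        apply Fin.ext
        omega
    · rw [Fin.sum_univ_succ, Fin.sum_univ_succ]
      simp only [g, Fin.cons_zero, Fin.cons_succ, Finset.sum_add_distrib]
      have h2 : ∑ j : Fin n, (d j.succ - (b j : ℕ)) + S b = ∑ j : Fin n, d j.succ := by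
        simp only [S]
        rw [← Finset.sum_add_distrib]
        exact Finset.sum_congr rfl fun j _ => Nat.sub_add_cancel (hbl j)
      have h3 : ∑ j, (b' j : ℕ) = S b' := rfl
      omega
  simp only [hval] at hzero
  simp at hzero
  exact hb hzero



/-- The Waring rank over `ℂ` of the monomial `x_0^{d_0} x_1^{d_1} ⋯ x_n^{d_n}` with
`1 ≤ d_0 ≤ d_1 ≤ … ≤ d_n` is exactly `∏_{j=1}^n (d_j + 1)`: this is the least size of
a decomposition `Σ_i λ_i z_i^{⊗d}` of the monomial (in particular a decomposition of
this size exists). -/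
theorem statement18 (n : ℕ) (hn : 1 ≤ n) (d : Fin (n+1) → ℕ)
    (hd0 : 1 ≤ d 0) (hmono : Monotone d) :
    IsLeast {s : ℕ | ∃ (lam : Fin s → ℂ) (z : Fin s → Fin (n+1) → ℂ),
        ∀ γ : Fin (n+1) → ℕ, (∑ j, γ j = ∑ j, d j) →
          (∑ i, lam i * ∏ j, z i j ^ γ j) = if γ = d then 1 else 0}
      (∏ j : Fin n, (d j.succ + 1)) := by
  refine ⟨upper n d hmono, ?_⟩
  rintro s ⟨lam, z, h⟩
  exact lower n d hd0 s lam z h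
end
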